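/- arXiv:2510.08526 — 8 statements merged into one kernel-verified Lean document; each statement's English description precedes it below -/
import Mathlib

section
/- For any policy π and any initial distribution ν₀ on 𝒳, the occupancy measure μ^π is a probability measure on 𝒳 × 𝒜 and satisfies the Bellman flow equation: for every Borel set E ⊆ 𝒳, μ^π(E × 𝒜) = (1−γ) ν₀(E) + γ ∫ P_{x,a}(E) dμ^π(x,a). -/
open MeasureTheory ProbabilityTheory ENNReal

/-- The one-step state-action transition kernel: `(x,a)` is sent to the measure on `𝒳 × 𝒜`
with `𝒳`-marginal `P_{x,a}` and conditional distributions `π_{x′}`. -/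
noncomputable def stepKernel {X A : Type*} [MeasurableSpace X] [MeasurableSpace A]
    (P : Kernel (X × A) X) (pol : Kernel X A) [IsSFiniteKernel P] [IsSFiniteKernel pol] :
    Kernel (X × A) (X × A) :=
  P ⊗ₖ (pol.comap Prod.snd measurable_snd)

/-- The sequence of laws `μ_t^π` of state-action pairs: `μ₀^π = ν₀ ⊗ π` and
`μ_{t+1}^π` is the image of `μ_t^π` under the one-step transition kernel. -/
noncomputable def occSeq {X A : Type*} [MeasurableSpace X] [MeasurableSpace A]
    (P : Kernel (X × A) X) (pol : Kernel X A) [IsSFiniteKernel P] [IsSFiniteKernel pol]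
    (ν₀ : Measure X) : ℕ → Measure (X × A)
  | 0 => ν₀ ⊗ₘ pol
  | t + 1 => (occSeq P pol ν₀ t).bind (stepKernel P pol)

/-- The (discounted, state-action) occupancy measure `μ^π = (1−γ) Σ_t γ^t μ_t^π`. -/
noncomputable def occupancy {X A : Type*} [MeasurableSpace X] [MeasurableSpace A]
    (P : Kernel (X × A) X) (pol : Kernel X A) [IsSFiniteKernel P] [IsSFiniteKernel pol]
    (ν₀ : Measure X) (γ : ℝ) : Measure (X × A) :=
  (1 - ENNReal.ofReal γ) • Measure.sum (fun t => (ENNReal.ofReal γ) ^ t • occSeq P pol ν₀ t)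

section Occupancy

variable {X A : Type*} [MeasurableSpace X] [MeasurableSpace A]
  (P : Kernel (X × A) X) [IsMarkovKernel P] (pol : Kernel X A) [IsMarkovKernel pol]

instance stepKernel.instIsMarkovKernel : IsMarkovKernel (stepKernel P pol) := by
  unfold stepKernel
  infer_instance

instance occSeq.instIsProbabilityMeasure (ν₀ : Measure X) [IsProbabilityMeasure ν₀] (t : ℕ) :
    IsProbabilityMeasure (occSeq P pol ν₀ t) := by
  induction t with
  | zero =>
    unfold occSeq
    infer_instance
  | succ t ih =>
    unfold occSeq
    infer_instance

lemma stepKernel_prod_univ (p : X × A) {E : Set X} (hE : MeasurableSet E) :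
    stepKernel P pol p (E ×ˢ Set.univ) = P p E := by
  have h : (stepKernel P pol).fst = P := Kernel.fst_compProd _ _
  conv_rhs => rw [← h, Kernel.fst_apply' _ _ hE]
  rw [Set.prod_univ]
  rfl

lemma occSeq_zero_prod_univ (ν₀ : Measure X) [SFinite ν₀] {E : Set X} (hE : MeasurableSet E) :
    occSeq P pol ν₀ 0 (E ×ˢ Set.univ) = ν₀ E := by
  rw [occSeq, Set.prod_univ, ← Measure.fst_apply hE, Measure.fst_compProd]

lemma occSeq_succ_prod_univ (ν₀ : Measure X) (t : ℕ) {E : Set X} (hE : MeasurableSet E) :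
    occSeq P pol ν₀ (t + 1) (E ×ˢ Set.univ) = ∫⁻ p, P p E ∂(occSeq P pol ν₀ t) := by
  rw [occSeq, Measure.bind_apply (hE.prod MeasurableSet.univ) (Kernel.aemeasurable _)]
  simp_rw [stepKernel_prod_univ P pol _ hE]

lemma lintegral_occupancy (ν₀ : Measure X) (γ : ℝ) (f : X × A → ℝ≥0∞) :
    ∫⁻ p, f p ∂(occupancy P pol ν₀ γ) =
      (1 - ENNReal.ofReal γ) *
        ∑' t, ENNReal.ofReal γ ^ t * ∫⁻ p, f p ∂(occSeq P pol ν₀ t) := by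
  simp [occupancy, lintegral_smul_measure, lintegral_sum_measure]

lemma occupancy_apply (ν₀ : Measure X) (γ : ℝ) {S : Set (X × A)} (hS : MeasurableSet S) :
    occupancy P pol ν₀ γ S =
      (1 - ENNReal.ofReal γ) * ∑' t, ENNReal.ofReal γ ^ t * occSeq P pol ν₀ t S := by
  simp [occupancy, Measure.sum_apply _ hS]

end Occupancy

/-- The occupancy measure is a probability measure and satisfies the Bellman flow equation:
for every Borel `E ⊆ 𝒳`, `μ^π(E × 𝒜) = (1−γ) ν₀(E) + γ ∫ P_{x,a}(E) dμ^π(x,a)`. -/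
theorem occupancy_isProbabilityMeasure_and_bellmanFlow
    {X A : Type*} [MeasurableSpace X] [MeasurableSpace A]
    [StandardBorelSpace X] [StandardBorelSpace A]
    (P : Kernel (X × A) X) [IsMarkovKernel P]
    (pol : Kernel X A) [IsMarkovKernel pol]
    (γ : ℝ) (hγ0 : 0 < γ) (hγ1 : γ < 1)
    (ν₀ : Measure X) [IsProbabilityMeasure ν₀] :
    IsProbabilityMeasure (occupancy P pol ν₀ γ) ∧
    ∀ E : Set X, MeasurableSet E →
      occupancy P pol ν₀ γ (E ×ˢ Set.univ) =
        (1 - ENNReal.ofReal γ) * ν₀ E +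
          ENNReal.ofReal γ * ∫⁻ p, P p E ∂(occupancy P pol ν₀ γ) := by
  have hlt : ENNReal.ofReal γ < 1 := by simpa using hγ1
  refine ⟨⟨?_⟩, fun E hE => ?_⟩
  · rw [occupancy_apply P pol ν₀ γ MeasurableSet.univ]
    simp only [measure_univ, mul_one, ENNReal.tsum_geometric]
    exact ENNReal.mul_inv_cancel (tsub_pos_of_lt hlt).ne' (by finiteness)
  · rw [occupancy_apply P pol ν₀ γ (hE.prod MeasurableSet.univ), lintegral_occupancy,
      tsum_eq_zero_add' ENNReal.summable]
    simp_rw [occSeq_succ_prod_univ P pol ν₀ _ hE, pow_succ', mul_assoc, ENNReal.tsum_mul_left]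
    rw [occSeq_zero_prod_univ P pol ν₀ hE]
    ring
end

section
/- Let 𝒳, 𝒜 be standard Borel spaces and let μ be a probability measure on 𝒳 × 𝒜 satisfying the Bellman flow equation for an initial distribution ν₀. Let π^μ be the policy obtained by disintegrating μ with respect to its 𝒳-marginal (the conditional distribution kernel of the second coordinate given the first). Then μ equals the occupancy measure of π^μ: μ = μ^{π^μ}. -/
open MeasureTheory ProbabilityTheory ENNReal

/-- Disintegration form of the step kernel: pushing `μ` through `stepKernel P pol` is
pushing it through `P` and then attaching the conditional distributions `pol`. -/
lemma bind_stepKernel {X A : Type*} [MeasurableSpace X] [MeasurableSpace A]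
    (P : Kernel (X × A) X) (pol : Kernel X A) [IsSFiniteKernel P] [IsSFiniteKernel pol]
    (μ : Measure (X × A)) [SFinite μ] :
    μ.bind (stepKernel P pol) = (μ.bind P) ⊗ₘ pol := by
  ext s hs
  have hm : Measurable fun x => pol x (Prod.mk x ⁻¹' s) :=
    Kernel.measurable_kernel_prodMk_left hs
  rw [Measure.bind_apply hs (Kernel.aemeasurable _), Measure.compProd_apply hs,
    Measure.lintegral_bind (Kernel.aemeasurable _) hm.aemeasurable]
  refine lintegral_congr fun p => ?_
  rw [stepKernel, Kernel.compProd_apply hs]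
  rfl

instance isMarkovKernel_stepKernel {X A : Type*} [MeasurableSpace X] [MeasurableSpace A]
    (P : Kernel (X × A) X) (pol : Kernel X A) [IsMarkovKernel P] [IsMarkovKernel pol] :
    IsMarkovKernel (stepKernel P pol) := by
  unfold stepKernel
  infer_instance

/-- The Bellman flow equation for `μ`, lifted from the marginal to `X × A`. -/
lemma eq_add_bind_stepKernel_of_bellmanFlow {X A : Type*} [MeasurableSpace X]
    [MeasurableSpace A] [StandardBorelSpace A] [Nonempty A]
    (P : Kernel (X × A) X) [IsSFiniteKernel P] (c g : ℝ≥0∞)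
    (ν₀ : Measure X) [SFinite ν₀] (μ : Measure (X × A)) [IsFiniteMeasure μ]
    (hflow : ∀ E : Set X, MeasurableSet E →
      μ (E ×ˢ Set.univ) = c * ν₀ E + g * ∫⁻ p, P p E ∂μ) :
    μ = c • (ν₀ ⊗ₘ μ.condKernel) + g • μ.bind (stepKernel P μ.condKernel) := by
  have hfst : μ.fst = c • ν₀ + g • μ.bind P := by
    ext E hE
    rw [Measure.fst_apply hE, ← Set.prod_univ, hflow E hE]
    simp [Measure.bind_apply hE (Kernel.aemeasurable P)]
  calc μ = μ.fst ⊗ₘ μ.condKernel := (μ.disintegrate μ.condKernel).symm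
    _ = _ := by
      rw [hfst, Measure.compProd_add_left, Measure.compProd_smul_left,
        Measure.compProd_smul_left, bind_stepKernel]

/-- Unrolling a one-step flow equation along the occupancy sequence. -/
lemma eq_sum_occSeq_add_of_eq_add_bind {X A : Type*} [MeasurableSpace X] [MeasurableSpace A]
    (P : Kernel (X × A) X) (pol : Kernel X A) [IsSFiniteKernel P] [IsSFiniteKernel pol]
    (ν₀ : Measure X) (μ : Measure (X × A)) (c g : ℝ≥0∞)
    (h : μ = c • (ν₀ ⊗ₘ pol) + g • μ.bind (stepKernel P pol)) (n : ℕ) :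
    μ = c • ∑ t ∈ Finset.range n, g ^ t • occSeq P pol ν₀ t +
      g ^ n • (fun ρ => Measure.bind ρ (stepKernel P pol))^[n] μ := by
  have hstep (n : ℕ) : (fun ρ => Measure.bind ρ (stepKernel P pol))^[n] μ =
      c • occSeq P pol ν₀ n +
        g • (fun ρ => Measure.bind ρ (stepKernel P pol))^[n + 1] μ := by
    induction n with
    | zero => exact h
    | succ n ih =>
      rw [Function.iterate_succ_apply' _ (n + 1)]
      conv_lhs => rw [Function.iterate_succ_apply', ih]
      simp only [Measure.comp_add, Measure.comp_smul, occSeq]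
  induction n with
  | zero => simp
  | succ n ih =>
    conv_lhs => rw [ih, hstep n]
    rw [Finset.sum_range_succ, smul_add, smul_add, smul_smul, smul_smul, smul_smul,
      pow_succ, mul_comm (g ^ n) c, add_assoc]

/-- Any probability measure `μ` on `𝒳 × 𝒜` satisfying the Bellman flow equation equals the
occupancy measure of the policy `π^μ` obtained by disintegrating `μ` with respect to its
`𝒳`-marginal. -/
theorem bellmanFlow_eq_occupancy_of_condKernel
    {X A : Type*} [MeasurableSpace X] [MeasurableSpace A]
    [StandardBorelSpace X] [StandardBorelSpace A] [Nonempty A]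
    (P : Kernel (X × A) X) [IsMarkovKernel P]
    (γ : ℝ) (hγ0 : 0 < γ) (hγ1 : γ < 1)
    (ν₀ : Measure X) [IsProbabilityMeasure ν₀]
    (μ : Measure (X × A)) [IsProbabilityMeasure μ]
    (hflow : ∀ E : Set X, MeasurableSet E →
      μ (E ×ˢ Set.univ) =
        (1 - ENNReal.ofReal γ) * ν₀ E + ENNReal.ofReal γ * ∫⁻ p, P p E ∂μ) :
    μ = occupancy P μ.condKernel ν₀ γ := by
  set g := ENNReal.ofReal γ with hg
  have hg1 : g < 1 := by rw [hg]; exact ENNReal.ofReal_lt_one.2 hγ1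
  have hμ := eq_sum_occSeq_add_of_eq_add_bind P μ.condKernel ν₀ μ (1 - g) g
    (eq_add_bind_stepKernel_of_bellmanFlow P (1 - g) g ν₀ μ hflow)
  set R := fun n => (fun ρ => Measure.bind ρ (stepKernel P μ.condKernel))^[n] μ with hR
  have hprob (n : ℕ) : IsProbabilityMeasure (R n) := by
    induction n with
    | zero => assumption
    | succ n ih =>
      simp only [hR, Function.iterate_succ_apply'] at ih ⊢
      infer_instance
  ext s hs
  have hrem : Filter.Tendsto (fun n => g ^ n * R n s) Filter.atTop (nhds 0) :=
    tendsto_of_tendsto_of_tendsto_of_le_of_le tendsto_const_nhds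
      (ENNReal.tendsto_pow_atTop_nhds_zero_of_lt_one hg1) (fun _ => zero_le)
      (fun n => mul_le_of_le_one_right' prob_le_one)
  have hsum : Filter.Tendsto
      (fun n => (1 - g) * ∑ t ∈ Finset.range n, g ^ t * occSeq P μ.condKernel ν₀ t s)
      Filter.atTop (nhds (occupancy P μ.condKernel ν₀ γ s)) := by
    simp only [occupancy, Measure.smul_apply, Measure.sum_apply _ hs, smul_eq_mul, ← hg]
    exact ENNReal.Tendsto.const_mul (ENNReal.tendsto_nat_tsum _)
      (Or.inr (ne_top_of_le_ne_top one_ne_top tsub_le_self))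
  have hlim := hsum.add hrem
  rw [add_zero] at hlim
  refine tendsto_nhds_unique (tendsto_const_nhds.congr fun n => ?_) hlim
  conv_lhs => rw [hμ n]
  simp [hR]
end

section
/- Let τ > 0 and let q*_τ be the unique bounded measurable fixed point of the soft Bellman optimality operator B*_τ. Let π* be the Boltzmann–Gibbs policy of q*_τ: for each x, π*ₓ is the probability measure with density a ↦ exp((q*_τ(x,a) − (V_τ q*_τ)(x))/τ) with respect to π̄ₓ. Then q*_τ is a fixed point of the soft Bellman policy-evaluation operator B^{π*}_τ, i.e., q*_τ = B^{π*}_τ q*_τ, and hence q*_τ = q^{π*}_τ, the unique bounded fixed point of B^{π*}_τ. -/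
open MeasureTheory ProbabilityTheory ENNReal

/-- Bounded measurable real-valued functions. -/
def BoundedMeasurable {Ω : Type*} [MeasurableSpace Ω] (q : Ω → ℝ) : Prop :=
  Measurable q ∧ ∃ C : ℝ, ∀ p, |q p| ≤ C

open Classical in
/-- Kullback–Leibler divergence. -/
noncomputable def KL {Ω : Type*} [MeasurableSpace Ω] (μ ν : Measure Ω) : ℝ≥0∞ :=
  if μ ≪ ν ∧ Integrable (llr μ ν) μ then ENNReal.ofReal (∫ x, llr μ ν x ∂μ) else ⊤

/-- The soft value `(V_τ q)(x) = τ log ∫ exp(q(x,a)/τ) dπ̄ₓ(a)`. -/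
noncomputable def softV {X A : Type*} [MeasurableSpace X] [MeasurableSpace A]
    (τ : ℝ) (piRef : Kernel X A) (q : X × A → ℝ) (x : X) : ℝ :=
  τ * Real.log (∫ a, Real.exp (q (x, a) / τ) ∂(piRef x))

/-- The soft Bellman optimality operator. -/
noncomputable def softBellmanOpt {X A : Type*} [MeasurableSpace X] [MeasurableSpace A]
    (τ γ : ℝ) (r : X × A → ℝ) (P : Kernel (X × A) X) (piRef : Kernel X A)
    (q : X × A → ℝ) : X × A → ℝ :=
  fun p => r p + γ * ∫ x', softV τ piRef q x' ∂(P p)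

/-- The soft Bellman policy-evaluation operator. -/
noncomputable def softBellmanEval {X A : Type*} [MeasurableSpace X] [MeasurableSpace A]
    (τ γ : ℝ) (r : X × A → ℝ) (P : Kernel (X × A) X) (piRef : Kernel X A)
    (pol : Kernel X A) (q : X × A → ℝ) : X × A → ℝ :=
  fun p => r p + γ *
    ∫ x', ((∫ a', q (x', a') ∂(pol x')) - τ * (KL (pol x') (piRef x')).toReal) ∂(P p)

/-- The log-likelihood ratio of a measure with exponential density is its exponent. -/
lemma llr_withDensity_exp {Ω : Type*} [MeasurableSpace Ω] {ν : Measure Ω} [SigmaFinite ν]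
    {g : Ω → ℝ} (hg : Measurable g) :
    llr (ν.withDensity fun a => ENNReal.ofReal (Real.exp (g a))) ν
      =ᵐ[ν.withDensity fun a => ENNReal.ofReal (Real.exp (g a))] g := by
  have hae := Measure.rnDeriv_withDensity ν (f := fun a => ENNReal.ofReal (Real.exp (g a)))
    (by fun_prop)
  filter_upwards [(withDensity_absolutelyContinuous ν _).ae_le hae] with a ha
  simp only [llr, ha]
  rw [ENNReal.toReal_ofReal (Real.exp_pos _).le, Real.log_exp]

lemma BoundedMeasurable.integrable {Ω : Type*} [MeasurableSpace Ω] {g : Ω → ℝ}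
    (hg : BoundedMeasurable g) (μ : Measure Ω) [IsFiniteMeasure μ] : Integrable g μ := by
  obtain ⟨hm, C, hC⟩ := hg
  exact .of_bound hm.aestronglyMeasurable C (ae_of_all _ hC)

/-- The Kullback–Leibler divergence of a probability measure with bounded log-density. -/
lemma toReal_KL_of_eq_withDensity_exp {Ω : Type*} [MeasurableSpace Ω] {μ ν : Measure Ω}
    [IsProbabilityMeasure μ] [IsProbabilityMeasure ν] {g : Ω → ℝ} (hg : BoundedMeasurable g)
    (hμ : μ = ν.withDensity fun a => ENNReal.ofReal (Real.exp (g a))) :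
    (KL μ ν).toReal = ∫ a, g a ∂μ := by
  have hac : μ ≪ ν := hμ ▸ withDensity_absolutelyContinuous _ _
  have hllr : llr μ ν =ᵐ[μ] g := by
    rw [hμ]
    exact llr_withDensity_exp hg.1
  have hint : Integrable (llr μ ν) μ := (integrable_congr hllr).2 (hg.integrable μ)
  have hnonneg := InformationTheory.integral_llr_add_sub_measure_univ_nonneg hac hint
  simp only [probReal_univ, add_sub_cancel_right] at hnonneg
  rw [KL, if_pos ⟨hac, hint⟩, ENNReal.toReal_ofReal hnonneg, integral_congr_ae hllr]

lemma BoundedMeasurable.sub {Ω : Type*} [MeasurableSpace Ω] {f g : Ω → ℝ}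
    (hf : BoundedMeasurable f) (hg : BoundedMeasurable g) :
    BoundedMeasurable fun p => f p - g p := by
  obtain ⟨hf, C, hC⟩ := hf
  obtain ⟨hg, D, hD⟩ := hg
  exact ⟨hf.sub hg, C + D, fun p => (abs_sub _ _).trans (add_le_add (hC p) (hD p))⟩

lemma abs_integral_le_of_abs_le {Ω : Type*} [MeasurableSpace Ω] {μ : Measure Ω}
    [IsProbabilityMeasure μ] {f : Ω → ℝ} {C : ℝ} (hf : ∀ a, |f a| ≤ C) :
    |∫ a, f a ∂μ| ≤ C := by
  simpa using norm_integral_le_of_norm_le_const (μ := μ) (f := f) (C := C) (ae_of_all _ hf)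

section SoftBellman

variable {X A : Type*} [MeasurableSpace X] [MeasurableSpace A]

lemma BoundedMeasurable.section_right {q : X × A → ℝ} (hq : BoundedMeasurable q) (x : X) :
    BoundedMeasurable fun a => q (x, a) :=
  ⟨hq.1.comp measurable_prodMk_left, hq.2.imp fun _ hC _ => hC _⟩

lemma BoundedMeasurable.integral_kernel {κ : Kernel X A} [IsMarkovKernel κ] {q : X × A → ℝ}
    (hq : BoundedMeasurable q) : BoundedMeasurable fun x => ∫ a, q (x, a) ∂(κ x) := by
  obtain ⟨hm, C, hC⟩ := hq
  exact ⟨(StronglyMeasurable.integral_kernel_prod_right' hm.stronglyMeasurable).measurable, C,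
    fun x => abs_integral_le_of_abs_le fun a => hC (x, a)⟩

lemma BoundedMeasurable.softV {τ : ℝ} (hτ : 0 < τ) {piRef : Kernel X A} [IsMarkovKernel piRef]
    {q : X × A → ℝ} (hq : BoundedMeasurable q) : BoundedMeasurable (softV τ piRef q) := by
  obtain ⟨hm, C, hC⟩ := hq
  have hexp : Measurable fun p : X × A => Real.exp (q p / τ) := by fun_prop
  have hZm : Measurable fun x => ∫ a, Real.exp (q (x, a) / τ) ∂(piRef x) :=
    (StronglyMeasurable.integral_kernel_prod_right' hexp.stronglyMeasurable).measurable
  refine ⟨(Real.measurable_log.comp hZm).const_mul τ, C, fun x => ?_⟩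
  have hup (a : A) : Real.exp (q (x, a) / τ) ≤ Real.exp (C / τ) := by
    gcongr
    exact (abs_le.1 (hC _)).2
  have hlow (a : A) : Real.exp (-C / τ) ≤ Real.exp (q (x, a) / τ) := by
    gcongr
    exact (abs_le.1 (hC _)).1
  have hint : Integrable (fun a => Real.exp (q (x, a) / τ)) (piRef x) :=
    .of_bound (hexp.comp measurable_prodMk_left).aestronglyMeasurable (Real.exp (C / τ))
      (ae_of_all _ fun a => by simpa using hup a)
  have hZup : ∫ a, Real.exp (q (x, a) / τ) ∂(piRef x) ≤ Real.exp (C / τ) := by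
    simpa using integral_mono hint (integrable_const _) hup
  have hZlow : Real.exp (-C / τ) ≤ ∫ a, Real.exp (q (x, a) / τ) ∂(piRef x) := by
    simpa using integral_mono (integrable_const _) hint hlow
  have hZpos := (Real.exp_pos _).trans_le hZlow
  have h1 := (Real.log_le_iff_le_exp hZpos).2 hZup
  have h2 := (Real.le_log_iff_exp_le hZpos).2 hZlow
  rw [le_div_iff₀' hτ] at h1
  rw [div_le_iff₀' hτ] at h2
  exact abs_le.2 ⟨h2, h1⟩

/-- Evaluation under the Boltzmann–Gibbs policy of `q₀`: the entropy-regularised value of `q`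
differs from the soft value of `q₀` by the policy average of `q - q₀`. -/
lemma integral_sub_KL_boltzmannGibbs {τ : ℝ} (hτ : 0 < τ) {piRef pol : Kernel X A}
    [IsMarkovKernel piRef] [IsMarkovKernel pol] {q₀ q : X × A → ℝ}
    (hq₀ : BoundedMeasurable q₀) (hq : BoundedMeasurable q) (x : X)
    (hpol : pol x = (piRef x).withDensity
      (fun a => ENNReal.ofReal (Real.exp ((q₀ (x, a) - softV τ piRef q₀ x) / τ)))) :
    (∫ a, q (x, a) ∂(pol x)) - τ * (KL (pol x) (piRef x)).toReal
      = (∫ a, (q (x, a) - q₀ (x, a)) ∂(pol x)) + softV τ piRef q₀ x := by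
  have hg : BoundedMeasurable fun a => (q₀ (x, a) - softV τ piRef q₀ x) / τ := by
    obtain ⟨hm, C, hC⟩ := (hq₀.section_right x).sub
      (⟨measurable_const, |softV τ piRef q₀ x|, fun _ => le_rfl⟩ :
        BoundedMeasurable fun _ : A => softV τ piRef q₀ x)
    refine ⟨hm.div_const τ, C / τ, fun a => ?_⟩
    rw [abs_div, abs_of_pos hτ]
    gcongr
    exact hC a
  have hi₀ := (hq₀.section_right x).integrable (pol x)
  have hi := (hq.section_right x).integrable (pol x)
  rw [toReal_KL_of_eq_withDensity_exp hg hpol, integral_div, integral_sub hi₀ (integrable_const _),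
    integral_sub hi hi₀, mul_div_cancel₀ _ hτ.ne']
  simp
  ring

end SoftBellman

/-- If `q*_τ` is the bounded measurable fixed point of the soft Bellman optimality operator and
`π*` is its Boltzmann–Gibbs policy, then `q*_τ` is a fixed point of the soft Bellman
policy-evaluation operator `B^{π*}_τ`, and in fact its unique bounded measurable fixed point. -/
theorem qStar_fixedPoint_of_boltzmannGibbs_eval
    {X A : Type*} [MeasurableSpace X] [MeasurableSpace A]
    [StandardBorelSpace X] [StandardBorelSpace A]
    (P : Kernel (X × A) X) [IsMarkovKernel P]
    (piRef : Kernel X A) [IsMarkovKernel piRef]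
    (r : X × A → ℝ) (hr : BoundedMeasurable r)
    (γ : ℝ) (hγ0 : 0 < γ) (hγ1 : γ < 1)
    (τ : ℝ) (hτ : 0 < τ)
    (qstar : X × A → ℝ) (hq : BoundedMeasurable qstar)
    (hfix : softBellmanOpt τ γ r P piRef qstar = qstar)
    (polStar : Kernel X A) [IsMarkovKernel polStar]
    (hpol : ∀ x : X, polStar x = (piRef x).withDensity
      (fun a => ENNReal.ofReal (Real.exp ((qstar (x, a) - softV τ piRef qstar x) / τ)))) :
    softBellmanEval τ γ r P piRef polStar qstar = qstar ∧
    (∀ q : X × A → ℝ, BoundedMeasurable q →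
      softBellmanEval τ γ r P piRef polStar q = q → q = qstar) := by
  have heval (q : X × A → ℝ) (hqb : BoundedMeasurable q) (p : X × A) :
      softBellmanEval τ γ r P piRef polStar q p
        = qstar p + γ * ∫ x', (∫ a', (q (x', a') - qstar (x', a')) ∂(polStar x')) ∂(P p) := by
    have hfp := congrFun hfix p
    simp only [softBellmanOpt] at hfp
    simp only [softBellmanEval, integral_sub_KL_boltzmannGibbs hτ hq hqb _ (hpol _)]
    rw [integral_add ((hqb.sub hq).integral_kernel.integrable _) ((hq.softV hτ).integrable _)]
    linarith
  refine ⟨funext fun p => by simp [heval qstar hq p], fun q hqb hqfix => ?_⟩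
  obtain ⟨-, D, hD⟩ := hqb.sub hq
  have hbound (n : ℕ) : ∀ p, |q p - qstar p| ≤ γ ^ n * D := by
    induction n with
    | zero => simpa using hD
    | succ n ih =>
      intro p
      have hp := heval q hqb p
      rw [hqfix] at hp
      rw [hp, add_sub_cancel_left, abs_mul, abs_of_pos hγ0, pow_succ', mul_assoc]
      gcongr
      exact abs_integral_le_of_abs_le fun x' => abs_integral_le_of_abs_le fun a' => ih (x', a')
  funext p
  have hlim : Filter.Tendsto (fun n : ℕ => γ ^ n * D) Filter.atTop (nhds 0) := by
    simpa using (tendsto_pow_atTop_nhds_zero_of_lt_one hγ0.le hγ1).mul_const D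
  exact sub_eq_zero.1 (abs_nonpos_iff.1 (ge_of_tendsto' hlim fun n => hbound n p))
end

section
/- Let 𝒳 and 𝒜 be finite sets. Suppose there exists μ* ∈ argmax_{D(ν₀)} J₀ with R(μ*) < ∞. For each τ > 0, J_τ has a unique maximizer μ*_τ over D(ν₀). Then, as τ → 0⁺, the measures μ*_τ converge setwise (equivalently, pointwise on subsets of the finite set 𝒳 × 𝒜) to a unique limit μ*₀, and μ*₀ is the unique minimizer of R over the set argmax_{D(ν₀)} J₀. -/
open MeasureTheory ProbabilityTheory ENNReal Filter Topology

/-- The entropy regularizer `R(μ) = KL(μ ‖ π̄ ⊗ ν^μ)`. -/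
noncomputable def Rreg {X A : Type*} [MeasurableSpace X] [MeasurableSpace A]
    (piRef : Kernel X A) (μ : Measure (X × A)) : ℝ≥0∞ :=
  KL μ ((μ.map Prod.fst) ⊗ₘ piRef)

/-- The entropy-regularized objective `J_τ(μ) = ∫ r dμ − τ R(μ)`, valued in the extended reals
(`J_τ(μ) = −∞` when `τ > 0` and `R(μ) = ∞`). -/
noncomputable def Jobj {X A : Type*} [MeasurableSpace X] [MeasurableSpace A]
    (τ : ℝ) (r : X × A → ℝ) (piRef : Kernel X A) (μ : Measure (X × A)) : EReal :=
  ((∫ p, r p ∂μ : ℝ) : EReal) - (τ : EReal) * (Rreg piRef μ : EReal)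

/-- The set `D(ν₀)` of probability measures on `𝒳 × 𝒜` satisfying the Bellman flow equation. -/
def Dset {X A : Type*} [MeasurableSpace X] [MeasurableSpace A]
    (P : Kernel (X × A) X) (γ : ℝ) (ν₀ : Measure X) : Set (Measure (X × A)) :=
  {μ | IsProbabilityMeasure μ ∧ ∀ x : X,
    μ ({x} ×ˢ Set.univ) =
      (1 - ENNReal.ofReal γ) * ν₀ {x} + ENNReal.ofReal γ * ∫⁻ p, P p {x} ∂μ}

/-- The maximizers of `f - τ H` over a compact set converge, as `τ → 0⁺`, to the maximizer of `f`
that minimizes `H`, when the latter is unique. -/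
theorem tendsto_of_vanishing_regularization {E : Type*} [TopologicalSpace E] {K : Set E}
    (hK : IsCompact K) {f H : E → ℝ} (hf : Continuous f) (hH : Continuous H) {q : E} (hq : q ∈ K)
    (huniq : ∀ y ∈ K, f q ≤ f y → H y ≤ H q → y = q) (hmax : ∀ y ∈ K, f y ≤ f q) {p : ℝ → E}
    (hp : ∀ τ, 0 < τ → p τ ∈ K ∧ f q - τ * H q ≤ f (p τ) - τ * H (p τ)) :
    Tendsto p (𝓝[>] (0 : ℝ)) (𝓝 q) := by
  have hpos : ∀ᶠ τ : ℝ in 𝓝[>] (0 : ℝ), 0 < τ := eventually_mem_nhdsWithin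
  refine hK.tendsto_nhds_of_unique_mapClusterPt (hpos.mono fun τ hτ => (hp τ hτ).1) ?_
  intro y hy hcl
  obtain ⟨m, -, hm⟩ := hK.exists_isMinOn ⟨q, hq⟩ hH.continuousOn
  refine huniq y hy ?_ ?_
  · by_contra! hlt
    have hlim : Tendsto (fun τ : ℝ => f q - τ * (H q - H m)) (𝓝[>] (0 : ℝ)) (𝓝 (f q)) := by
      have : Continuous fun τ : ℝ => f q - τ * (H q - H m) := by fun_prop
      simpa using (this.tendsto 0).mono_left nhdsWithin_le_nhds
    have hev : ∀ᶠ τ in 𝓝[>] (0 : ℝ), p τ ∈ {z | (f y + f q) / 2 ≤ f z} := by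
      filter_upwards [hpos, hlim.eventually_const_lt (u := (f y + f q) / 2) (by linarith)]
        with τ hτ h
      obtain ⟨hpK, hle⟩ := hp τ hτ
      have := mul_le_mul_of_nonneg_left (isMinOn_iff.1 hm _ hpK) hτ.le
      change (f y + f q) / 2 ≤ f (p τ)
      nlinarith
    have := (isClosed_le continuous_const hf).mem_of_mapClusterPt hcl hev
    simp only [Set.mem_ofPred_eq] at this
    linarith
  · refine (isClosed_le hH continuous_const).mem_of_mapClusterPt hcl ?_
    filter_upwards [hpos] with τ hτ
    obtain ⟨hpK, hle⟩ := hp τ hτ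
    have := hmax _ hpK
    exact le_of_mul_le_mul_left (by linarith) hτ

/-- Log-sum inequality for midpoints. -/
theorem two_mul_midpoint_mul_log_div_le {u₁ u₂ v₁ v₂ : ℝ} (hu₁ : 0 ≤ u₁) (hu₂ : 0 ≤ u₂)
    (h₁ : u₁ ≤ v₁) (h₂ : u₂ ≤ v₂) :
    2 * ((u₁ + u₂) / 2 * Real.log ((u₁ + u₂) / 2 / ((v₁ + v₂) / 2))) ≤
        u₁ * Real.log (u₁ / v₁) + u₂ * Real.log (u₂ / v₂) ∧
      (2 * ((u₁ + u₂) / 2 * Real.log ((u₁ + u₂) / 2 / ((v₁ + v₂) / 2))) =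
        u₁ * Real.log (u₁ / v₁) + u₂ * Real.log (u₂ / v₂) → u₁ * v₂ = u₂ * v₁) := by
  rw [div_div_div_cancel_right₀ two_ne_zero]
  rcases (hu₁.trans h₁).eq_or_lt with hv₁ | hv₁
  · obtain rfl : u₁ = 0 := by linarith
    subst hv₁
    refine ⟨le_of_eq ?_, fun _ => by simp⟩
    simp
    ring
  rcases (hu₂.trans h₂).eq_or_lt with hv₂ | hv₂
  · obtain rfl : u₂ = 0 := by linarith
    subst hv₂
    refine ⟨le_of_eq ?_, fun _ => by simp⟩
    simp
    ring
  have hV : 0 < v₁ + v₂ := by positivity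
  have hx : u₁ / v₁ ∈ Set.Ici (0 : ℝ) := by simp only [Set.mem_Ici]; positivity
  have hy : u₂ / v₂ ∈ Set.Ici (0 : ℝ) := by simp only [Set.mem_Ici]; positivity
  have ha : 0 < v₁ / (v₁ + v₂) := by positivity
  have hb : 0 < v₂ / (v₁ + v₂) := by positivity
  have hab : v₁ / (v₁ + v₂) + v₂ / (v₁ + v₂) = 1 := by field_simp
  have hmid : v₁ / (v₁ + v₂) * (u₁ / v₁) + v₂ / (v₁ + v₂) * (u₂ / v₂) =
      (u₁ + u₂) / (v₁ + v₂) := by field_simp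
  have hL : 2 * ((u₁ + u₂) / 2 * Real.log ((u₁ + u₂) / (v₁ + v₂))) =
      (v₁ + v₂) * ((u₁ + u₂) / (v₁ + v₂) * Real.log ((u₁ + u₂) / (v₁ + v₂))) := by field_simp
  have hR : u₁ * Real.log (u₁ / v₁) + u₂ * Real.log (u₂ / v₂) =
      (v₁ + v₂) * (v₁ / (v₁ + v₂) * (u₁ / v₁ * Real.log (u₁ / v₁)) +
        v₂ / (v₁ + v₂) * (u₂ / v₂ * Real.log (u₂ / v₂))) := by field_simp
  rw [hL, hR]
  constructor
  · refine mul_le_mul_of_nonneg_left ?_ hV.le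
    have := Real.convexOn_mul_log.2 hx hy ha.le hb.le hab
    simpa only [smul_eq_mul, hmid] using this
  · intro h
    by_contra hne
    have hne' : u₁ / v₁ ≠ u₂ / v₂ := by
      rwa [Ne, div_eq_div_iff hv₁.ne' hv₂.ne']
    have := Real.strictConvexOn_mul_log.2 hx hy hne' ha hb hab
    simp only [smul_eq_mul, hmid] at this
    exact (mul_lt_mul_of_pos_left this hV).ne h

section Occupancy

variable {X A : Type*} [Fintype A]

/-- State marginal of a mass function on state-action pairs. -/
def stateMarginal (p : X × A → ℝ) (x : X) : ℝ := ∑ a, p (x, a)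

theorem continuous_stateMarginal (x : X) :
    Continuous fun p : X × A → ℝ => stateMarginal p x := by
  unfold stateMarginal
  fun_prop

theorem le_stateMarginal {p : X × A → ℝ} (hp : ∀ z, 0 ≤ p z) (z : X × A) :
    p z ≤ stateMarginal p z.1 :=
  Finset.single_le_sum (f := fun a => p (z.1, a)) (fun _ _ => hp _) (Finset.mem_univ z.2)

variable [Fintype X]

/-- Conditional relative entropy of a mass function with respect to the reference policy `w`, in
a form that is continuous on the whole space of functions. -/
noncomputable def condRelEntropy (w p : X × A → ℝ) : ℝ :=
  ∑ z, (p z * Real.log (p z) - p z * Real.log (w z)) -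
    ∑ x, stateMarginal p x * Real.log (stateMarginal p x)

/-- Mass functions satisfying the flow equation with transitions `Q` and source `b`, and vanishing
wherever the reference policy `w` does. -/
def occupancySet (Q : X × A → X → ℝ) (b : X → ℝ) (γ : ℝ) (w : X × A → ℝ) : Set (X × A → ℝ) :=
  {p | (∀ z, 0 ≤ p z) ∧ ∑ z, p z = 1 ∧
    (∀ x, stateMarginal p x = b x + γ * ∑ z, p z * Q z x) ∧ ∀ z, w z = 0 → p z = 0}

theorem continuous_condRelEntropy (w : X × A → ℝ) : Continuous (condRelEntropy w) := by
  unfold condRelEntropy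
  refine .sub (continuous_finsetSum _ fun z _ => .sub ?_ ?_) (continuous_finsetSum _ fun x _ => ?_)
  · exact Real.continuous_mul_log.comp (continuous_apply z)
  · fun_prop
  · exact Real.continuous_mul_log.comp (continuous_stateMarginal x)

theorem condRelEntropy_eq {p : X × A → ℝ} (hp : ∀ z, 0 ≤ p z) (w : X × A → ℝ) :
    condRelEntropy w p =
      ∑ z, (p z * Real.log (p z / stateMarginal p z.1) - p z * Real.log (w z)) := by
  have h : ∑ x, stateMarginal p x * Real.log (stateMarginal p x) =
      ∑ z, p z * Real.log (stateMarginal p z.1) := by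
    rw [Fintype.sum_prod_type]
    refine Finset.sum_congr rfl fun x _ => ?_
    simp only [← Finset.sum_mul, stateMarginal]
  rw [condRelEntropy, h, ← Finset.sum_sub_distrib]
  refine Finset.sum_congr rfl fun z _ => ?_
  rcases (hp z).eq_or_lt with hz | hz
  · simp [← hz]
  · rw [Real.log_div hz.ne' (hz.trans_le (le_stateMarginal hp z)).ne']
    ring

theorem isCompact_occupancySet (Q : X × A → X → ℝ) (b : X → ℝ) (γ : ℝ) (w : X × A → ℝ) :
    IsCompact (occupancySet Q b γ w) := by
  refine (isCompact_univ_pi fun _ => isCompact_Icc (a := (0 : ℝ)) (b := 1)).of_isClosed_subset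
    ?_ ?_
  · simp only [occupancySet, Set.ofPred_and]
    refine .inter ?_ (.inter ?_ (.inter ?_ ?_))
    · simp only [Set.ofPred_forall]
      exact isClosed_iInter fun z => isClosed_le continuous_const (continuous_apply z)
    · exact isClosed_eq (by fun_prop) continuous_const
    · simp only [Set.ofPred_forall]
      exact isClosed_iInter fun x => isClosed_eq (continuous_stateMarginal x) (by fun_prop)
    · simp only [Set.ofPred_forall]
      exact isClosed_iInter fun z => isClosed_iInter fun _ =>
        isClosed_eq (continuous_apply z) continuous_const
  · rintro p ⟨h0, h1, -, -⟩ z -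
    exact ⟨h0 z, h1 ▸ Finset.single_le_sum (fun z _ => h0 z) (Finset.mem_univ z)⟩

theorem midpoint_mem_occupancySet {Q : X × A → X → ℝ} {b : X → ℝ} {γ : ℝ} {w p q : X × A → ℝ}
    (hp : p ∈ occupancySet Q b γ w) (hq : q ∈ occupancySet Q b γ w) :
    (fun z => (p z + q z) / 2) ∈ occupancySet Q b γ w := by
  obtain ⟨p0, p1, pf, pw⟩ := hp
  obtain ⟨q0, q1, qf, qw⟩ := hq
  refine ⟨fun z => by have := p0 z; have := q0 z; positivity, ?_, fun x => ?_, fun z hz => ?_⟩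
  · rw [← Finset.sum_div, Finset.sum_add_distrib, p1, q1]
    norm_num
  · have hpx := pf x
    have hqx := qf x
    simp only [stateMarginal] at hpx hqx ⊢
    rw [← Finset.sum_div, Finset.sum_add_distrib, hpx, hqx]
    simp only [add_mul, add_div, div_mul_eq_mul_div, Finset.sum_add_distrib, ← Finset.sum_div]
    ring
  · simp [pw z hz, qw z hz]

/-- Two solutions of the same discounted flow equation with the same conditional action
distributions coincide. -/
theorem occupancy_eq_of_mul_stateMarginal_eq {Q : X × A → X → ℝ} {b : X → ℝ} {γ : ℝ}
    {w p q : X × A → ℝ} (hQ0 : ∀ z x, 0 ≤ Q z x) (hQ1 : ∀ z, ∑ x, Q z x = 1) (hγ0 : 0 < γ)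
    (hγ1 : γ < 1) (hp : p ∈ occupancySet Q b γ w) (hq : q ∈ occupancySet Q b γ w)
    (h : ∀ z, p z * stateMarginal q z.1 = q z * stateMarginal p z.1) : p = q := by
  obtain ⟨p0, p1, pf, pw⟩ := hp
  obtain ⟨q0, q1, qf, qw⟩ := hq
  have hfib : ∀ x, ∑ a, |p (x, a) - q (x, a)| = |stateMarginal p x - stateMarginal q x| := by
    intro x
    have hsub : stateMarginal p x - stateMarginal q x = ∑ a, (p (x, a) - q (x, a)) := by
      simp [stateMarginal]
    rcases le_total (stateMarginal q x) (stateMarginal p x) with hle | hle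
    · rw [abs_of_nonneg (sub_nonneg.2 hle), hsub]
      refine Finset.sum_congr rfl fun a _ => abs_of_nonneg ?_
      have ha := h (x, a)
      simp only at ha
      have := le_stateMarginal p0 (x, a)
      have := le_stateMarginal q0 (x, a)
      have := p0 (x, a)
      have := q0 (x, a)
      simp only at *
      by_contra! hlt
      have : 0 < q (x, a) := by linarith
      nlinarith
    · rw [abs_of_nonpos (sub_nonpos.2 hle), hsub, ← Finset.sum_neg_distrib]
      refine Finset.sum_congr rfl fun a _ => abs_of_nonpos ?_
      have ha := h (x, a)
      simp only at ha
      have := le_stateMarginal p0 (x, a)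
      have := le_stateMarginal q0 (x, a)
      have := p0 (x, a)
      have := q0 (x, a)
      simp only at *
      by_contra! hlt
      have : 0 < p (x, a) := by linarith
      nlinarith
  have hcontr : ∑ z, |p z - q z| ≤ γ * ∑ z, |p z - q z| := by
    calc ∑ z, |p z - q z| = ∑ x, |stateMarginal p x - stateMarginal q x| := by
          rw [Fintype.sum_prod_type]
          exact Finset.sum_congr rfl fun x _ => hfib x
      _ = ∑ x, γ * |∑ z, (p z - q z) * Q z x| := by
          refine Finset.sum_congr rfl fun x _ => ?_
          rw [pf x, qf x, add_sub_add_left_eq_sub, ← mul_sub, ← Finset.sum_sub_distrib, abs_mul,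
            abs_of_pos hγ0]
          simp only [sub_mul]
      _ ≤ ∑ x, γ * ∑ z, |p z - q z| * Q z x := by
          refine Finset.sum_le_sum fun x _ => mul_le_mul_of_nonneg_left ?_ hγ0.le
          refine (Finset.abs_sum_le_sum_abs _ _).trans (le_of_eq ?_)
          exact Finset.sum_congr rfl fun z _ => by rw [abs_mul, abs_of_nonneg (hQ0 z x)]
      _ = γ * ∑ z, |p z - q z| := by
          rw [← Finset.mul_sum, Finset.sum_comm]
          simp only [← Finset.mul_sum, hQ1, mul_one]
  have hnn : 0 ≤ ∑ z, |p z - q z| := Finset.sum_nonneg fun z _ => abs_nonneg _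
  have hzero : ∑ z, |p z - q z| = 0 := by nlinarith
  funext z
  have := (Finset.sum_eq_zero_iff_of_nonneg fun z _ => abs_nonneg _).1 hzero z (Finset.mem_univ z)
  exact sub_eq_zero.1 (abs_eq_zero.1 this)

/-- Strict midpoint convexity of the conditional relative entropy on the occupancy set. -/
theorem occupancy_eq_of_condRelEntropy_midpoint {Q : X × A → X → ℝ} {b : X → ℝ} {γ : ℝ}
    {w p q : X × A → ℝ} (hQ0 : ∀ z x, 0 ≤ Q z x) (hQ1 : ∀ z, ∑ x, Q z x = 1) (hγ0 : 0 < γ)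
    (hγ1 : γ < 1) (hp : p ∈ occupancySet Q b γ w) (hq : q ∈ occupancySet Q b γ w)
    (h : condRelEntropy w p + condRelEntropy w q ≤
      2 * condRelEntropy w fun z => (p z + q z) / 2) : p = q := by
  refine occupancy_eq_of_mul_stateMarginal_eq hQ0 hQ1 hγ0 hγ1 hp hq fun z => ?_
  have hls := fun z => two_mul_midpoint_mul_log_div_le (hp.1 z) (hq.1 z)
    (le_stateMarginal hp.1 z) (le_stateMarginal hq.1 z)
  refine (hls z).2 ?_
  rw [condRelEntropy_eq hp.1, condRelEntropy_eq hq.1,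
    condRelEntropy_eq (midpoint_mem_occupancySet hp hq).1] at h
  have hmarg : ∀ x, stateMarginal (fun z => (p z + q z) / 2) x =
      (stateMarginal p x + stateMarginal q x) / 2 := fun x => by
    simp only [stateMarginal, ← Finset.sum_div, Finset.sum_add_distrib]
  simp only [hmarg] at h
  have hle := Finset.sum_le_sum fun z (_ : z ∈ Finset.univ) => (hls z).1
  have heq := (Finset.sum_eq_sum_iff_of_le fun z (_ : z ∈ Finset.univ) => (hls z).1).1
    (le_antisymm hle ?_) z (Finset.mem_univ z)
  · exact heq
  · simp only [add_div, add_mul, Finset.sum_sub_distrib, Finset.sum_add_distrib, mul_add, mul_sub,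
      div_mul_eq_mul_div, ← Finset.sum_div, ← Finset.mul_sum] at h ⊢
    linarith

end Occupancy

theorem Jobj_of_Rreg_eq_top {X A : Type*} [MeasurableSpace X] [MeasurableSpace A]
    {τ : ℝ} (hτ : 0 < τ) (r : X × A → ℝ) {piRef : Kernel X A}
    {μ : Measure (X × A)} (h : Rreg piRef μ = ⊤) : Jobj τ r piRef μ = ⊥ := by
  rw [Jobj, h, EReal.coe_ennreal_top, EReal.coe_mul_top_of_pos hτ, EReal.sub_top]

section Mass

variable {X A : Type*} [Fintype A]
    [MeasurableSpace X] [MeasurableSingletonClass X]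
    [MeasurableSpace A] [MeasurableSingletonClass A]

theorem stateMarginal_measureReal (μ : Measure (X × A)) [IsFiniteMeasure μ] (x : X) :
    stateMarginal (fun z => μ.real {z}) x = μ.real ({x} ×ˢ Set.univ) := by
  classical
  have h : ({x} ×ˢ Set.univ : Set (X × A)) =
      ((Finset.univ.image fun a => (x, a) : Finset (X × A)) : Set (X × A)) := by
    ext ⟨y, a⟩
    simp [eq_comm]
  rw [h, ← sum_measureReal_singleton, Finset.sum_image (Prod.mk_right_injective x).injOn]
  rfl

theorem compProd_fst_real_singleton (piRef : Kernel X A) [IsMarkovKernel piRef]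
    (μ : Measure (X × A)) [IsFiniteMeasure μ] (z : X × A) :
    ((μ.map Prod.fst) ⊗ₘ piRef).real {z} =
      stateMarginal (fun z => μ.real {z}) z.1 * (piRef z.1).real {z.2} := by
  obtain ⟨x, a⟩ := z
  rw [stateMarginal_measureReal, ← Set.singleton_prod_singleton, measureReal_def,
    Measure.compProd_apply_prod (.singleton x) (.singleton a), lintegral_singleton,
    Measure.map_apply measurable_fst (.singleton x), ENNReal.toReal_mul, mul_comm]
  congr
  ext ⟨y, c⟩
  simp

variable [Fintype X]

theorem absolutelyContinuous_iff_real_singleton {Ω : Type*} [Countable Ω] [MeasurableSpace Ω]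
    [MeasurableSingletonClass Ω] (μ ν : Measure Ω) [IsFiniteMeasure μ] [IsFiniteMeasure ν] :
    μ ≪ ν ↔ ∀ z, ν.real {z} = 0 → μ.real {z} = 0 := by
  have hreal : ∀ (m : Measure Ω) [IsFiniteMeasure m] (z : Ω), m.real {z} = 0 ↔ m {z} = 0 :=
    fun m _ z => measureReal_eq_zero_iff
  simp only [hreal]
  refine ⟨fun h z hz => h hz, fun h s hs => ?_⟩
  rw [← Set.biUnion_of_singleton s, measure_biUnion_null_iff s.to_countable]
  exact fun z hz => h z (measure_mono_null (Set.singleton_subset_iff.2 hz) hs)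

theorem llr_of_singleton_ne_zero {Ω : Type*} [MeasurableSpace Ω] [MeasurableSingletonClass Ω]
    {μ ν : Measure Ω} [IsFiniteMeasure μ] [IsFiniteMeasure ν] (hac : μ ≪ ν) {z : Ω}
    (hz : μ.real {z} ≠ 0) : llr μ ν z = Real.log (μ.real {z} / ν.real {z}) := by
  have hν : ν.real {z} ≠ 0 := fun h => hz ((measureReal_eq_zero_iff).2
    (hac ((measureReal_eq_zero_iff).1 h)))
  have h : μ.rnDeriv ν z * ν {z} = μ {z} := by
    rw [← lintegral_singleton, Measure.setLIntegral_rnDeriv hac]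
  rw [llr, measureReal_def, ← h, ENNReal.toReal_mul, ← measureReal_def,
    mul_div_cancel_right₀ _ hν]

theorem compProd_fst_absolutelyContinuous_iff (piRef : Kernel X A) [IsMarkovKernel piRef]
    (μ : Measure (X × A)) [IsFiniteMeasure μ] :
    μ ≪ (μ.map Prod.fst) ⊗ₘ piRef ↔ ∀ z, (piRef z.1).real {z.2} = 0 → μ.real {z} = 0 := by
  simp only [absolutelyContinuous_iff_real_singleton, compProd_fst_real_singleton, mul_eq_zero]
  refine forall_congr' fun z => ⟨fun h hz => h (.inr hz), fun h hz => hz.elim (fun h0 => ?_) h⟩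
  have := le_stateMarginal (p := fun z => μ.real {z}) (fun _ => measureReal_nonneg) z
  exact le_antisymm (this.trans_eq h0) measureReal_nonneg

theorem Rreg_eq_ofReal (piRef : Kernel X A) [IsMarkovKernel piRef]
    (μ : Measure (X × A)) [IsProbabilityMeasure μ]
    (h : ∀ z, (piRef z.1).real {z.2} = 0 → μ.real {z} = 0) :
    0 ≤ condRelEntropy (fun z => (piRef z.1).real {z.2}) (fun z => μ.real {z}) ∧
      Rreg piRef μ = ENNReal.ofReal
        (condRelEntropy (fun z => (piRef z.1).real {z.2}) (fun z => μ.real {z})) := by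
  have hac := (compProd_fst_absolutelyContinuous_iff piRef μ).2 h
  have : IsProbabilityMeasure (μ.map Prod.fst) :=
    Measure.isProbabilityMeasure_map measurable_fst.aemeasurable
  have hint : ∫ z, llr μ ((μ.map Prod.fst) ⊗ₘ piRef) z ∂μ =
      condRelEntropy (fun z => (piRef z.1).real {z.2}) (fun z => μ.real {z}) := by
    rw [integral_fintype .of_finite, condRelEntropy_eq fun _ => measureReal_nonneg]
    refine Finset.sum_congr rfl fun z _ => ?_
    by_cases hz : μ.real {z} = 0
    · simp [hz]
    have hw : (piRef z.1).real {z.2} ≠ 0 := fun h0 => hz (h z h0)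
    have hm : 0 < stateMarginal (fun z => μ.real {z}) z.1 :=
      (lt_of_le_of_ne measureReal_nonneg (Ne.symm hz)).trans_le
        (le_stateMarginal (fun _ => measureReal_nonneg) z)
    rw [llr_of_singleton_ne_zero hac hz, compProd_fst_real_singleton, ← div_div,
      Real.log_div (div_ne_zero hz hm.ne') hw, smul_eq_mul, mul_sub]
  have hnn := InformationTheory.integral_llr_add_sub_measure_univ_nonneg hac .of_finite
  constructor
  · simpa [hint] using hnn
  · rw [Rreg, KL, if_pos ⟨hac, .of_finite⟩, hint]

theorem eq_zero_of_Rreg_ne_top {piRef : Kernel X A} [IsMarkovKernel piRef]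
    {μ : Measure (X × A)} [IsFiniteMeasure μ] (h : Rreg piRef μ ≠ ⊤) (z : X × A)
    (hz : (piRef z.1).real {z.2} = 0) : μ.real {z} = 0 := by
  refine (compProd_fst_absolutelyContinuous_iff piRef μ).1 ?_ z hz
  by_contra hac
  exact h (if_neg fun h => hac h.1)

theorem Jobj_zero (r : X × A → ℝ) (piRef : Kernel X A)
    (μ : Measure (X × A)) [IsFiniteMeasure μ] :
    Jobj 0 r piRef μ = ((∑ z, μ.real {z} * r z : ℝ) : EReal) := by
  rw [Jobj, integral_fintype .of_finite]
  simp

theorem Jobj_eq_coe {τ : ℝ} (r : X × A → ℝ) (piRef : Kernel X A) [IsMarkovKernel piRef]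
    (μ : Measure (X × A)) [IsProbabilityMeasure μ]
    (h : ∀ z, (piRef z.1).real {z.2} = 0 → μ.real {z} = 0) :
    Jobj τ r piRef μ = ((∑ z, μ.real {z} * r z - τ *
      condRelEntropy (fun z => (piRef z.1).real {z.2}) (fun z => μ.real {z}) : ℝ) : EReal) := by
  obtain ⟨hnn, hR⟩ := Rreg_eq_ofReal piRef μ h
  rw [Jobj, integral_fintype .of_finite, hR, EReal.coe_ennreal_ofReal, max_eq_left hnn]
  simp

theorem mem_Dset_iff_real (P : Kernel (X × A) X) [IsMarkovKernel P] {γ : ℝ} (hγ0 : 0 < γ)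
    (hγ1 : γ < 1) (ν₀ : Measure X) [IsProbabilityMeasure ν₀] (μ : Measure (X × A))
    [IsProbabilityMeasure μ] :
    μ ∈ Dset P γ ν₀ ↔ ∀ x, stateMarginal (fun z => μ.real {z}) x =
      (1 - γ) * ν₀.real {x} + γ * ∑ z, μ.real {z} * (P z).real {x} := by
  simp only [Dset, Set.mem_ofPred_eq, stateMarginal_measureReal]
  refine (and_iff_right ‹IsProbabilityMeasure μ›).trans (forall_congr' fun x => ?_)
  have hsum : ∫⁻ p, P p {x} ∂μ ≠ ⊤ := by
    rw [lintegral_fintype]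
    exact ENNReal.sum_ne_top.2 fun z _ =>
      ENNReal.mul_ne_top (measure_ne_top _ _) (measure_ne_top _ _)
  have h1 : (1 - ENNReal.ofReal γ) * ν₀ {x} ≠ ⊤ :=
    ENNReal.mul_ne_top (by simp) (measure_ne_top _ _)
  have h2 : ENNReal.ofReal γ * ∫⁻ p, P p {x} ∂μ ≠ ⊤ := ENNReal.mul_ne_top (by simp) hsum
  rw [← ENNReal.toReal_eq_toReal_iff' (measure_ne_top _ _) (ENNReal.add_ne_top.2 ⟨h1, h2⟩),
    ENNReal.toReal_add h1 h2, ENNReal.toReal_mul, ENNReal.toReal_mul,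
    ENNReal.toReal_sub_of_le (by simpa using hγ1.le) (by simp), ENNReal.toReal_ofReal hγ0.le,
    lintegral_fintype, ENNReal.toReal_sum fun z _ =>
      ENNReal.mul_ne_top (measure_ne_top _ _) (measure_ne_top _ _)]
  simp only [ENNReal.toReal_mul, ENNReal.toReal_one, measureReal_def, mul_comm]

theorem exists_isProbabilityMeasure_real_singleton {Ω : Type*} [Fintype Ω] [MeasurableSpace Ω]
    [MeasurableSingletonClass Ω] {p : Ω → ℝ} (h0 : ∀ z, 0 ≤ p z) (h1 : ∑ z, p z = 1) :
    ∃ μ : Measure Ω, IsProbabilityMeasure μ ∧ (fun z => μ.real {z}) = p := by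
  classical
  have hz : ∀ z, (∑ y, ENNReal.ofReal (p y) • Measure.dirac y : Measure Ω) {z} =
      ENNReal.ofReal (p z) := fun z => by
    rw [Measure.finsetSum_apply, Finset.sum_eq_single z] <;> simp +contextual [eq_comm]
  refine ⟨∑ z, ENNReal.ofReal (p z) • Measure.dirac z, ⟨?_⟩, funext fun z => ?_⟩
  · simp [Measure.finsetSum_apply, ← ENNReal.ofReal_sum_of_nonneg fun z _ => h0 z, h1]
  · rw [measureReal_def, hz, ENNReal.toReal_ofReal (h0 z)]

end Mass

/-- In a finite MDP, if some maximizer of `J₀` over `D(ν₀)` has finite regularization, then the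
unique maximizers `μ*_τ` of `J_τ` converge setwise, as `τ → 0⁺`, to a unique limit `μ*₀`, which
is the unique minimizer of `R` over `argmax_{D(ν₀)} J₀`. -/
theorem optimal_occupancies_converge_vanishing_temperature
    {X A : Type*} [Fintype X] [Fintype A]
    [MeasurableSpace X] [MeasurableSingletonClass X]
    [MeasurableSpace A] [MeasurableSingletonClass A]
    (P : Kernel (X × A) X) [IsMarkovKernel P]
    (piRef : Kernel X A) [IsMarkovKernel piRef]
    (r : X × A → ℝ)
    (γ : ℝ) (hγ0 : 0 < γ) (hγ1 : γ < 1)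
    (ν₀ : Measure X) [IsProbabilityMeasure ν₀]
    (hassump : ∃ μs ∈ Dset P γ ν₀,
      (∀ μ' ∈ Dset P γ ν₀, Jobj 0 r piRef μ' ≤ Jobj 0 r piRef μs) ∧
      Rreg piRef μs ≠ ⊤)
    (μstar : ℝ → Measure (X × A))
    (hμstar : ∀ τ : ℝ, 0 < τ →
      μstar τ ∈ Dset P γ ν₀ ∧
      (∀ μ' ∈ Dset P γ ν₀, Jobj τ r piRef μ' ≤ Jobj τ r piRef (μstar τ)) ∧
      (∀ μ' ∈ Dset P γ ν₀,
        (∀ μ'' ∈ Dset P γ ν₀, Jobj τ r piRef μ'' ≤ Jobj τ r piRef μ') → μ' = μstar τ)) :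
    ∃ μlim : Measure (X × A),
      (∀ S : Set (X × A), Tendsto (fun τ => μstar τ S) (𝓝[>] (0 : ℝ)) (𝓝 (μlim S))) ∧
      μlim ∈ Dset P γ ν₀ ∧
      (∀ μ' ∈ Dset P γ ν₀, Jobj 0 r piRef μ' ≤ Jobj 0 r piRef μlim) ∧
      (∀ μ' ∈ Dset P γ ν₀,
        (∀ μ'' ∈ Dset P γ ν₀, Jobj 0 r piRef μ'' ≤ Jobj 0 r piRef μ') →
        Rreg piRef μlim ≤ Rreg piRef μ') ∧
      (∀ μ' ∈ Dset P γ ν₀,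
        (∀ μ'' ∈ Dset P γ ν₀, Jobj 0 r piRef μ'' ≤ Jobj 0 r piRef μ') →
        (∀ μ'' ∈ Dset P γ ν₀,
          (∀ μ''' ∈ Dset P γ ν₀, Jobj 0 r piRef μ''' ≤ Jobj 0 r piRef μ'') →
          Rreg piRef μ' ≤ Rreg piRef μ'') →
        μ' = μlim) := by
  set w : X × A → ℝ := fun z => (piRef z.1).real {z.2} with hw
  set Q : X × A → X → ℝ := fun z x => (P z).real {x} with hQ
  set b : X → ℝ := fun x => (1 - γ) * ν₀.real {x} with hb
  set f : (X × A → ℝ) → ℝ := fun p => ∑ z, p z * r z with hf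
  have hQ0 : ∀ z x, 0 ≤ Q z x := fun _ _ => measureReal_nonneg
  have hQ1 : ∀ z, ∑ x, Q z x = 1 := fun z => by simp [hQ]
  have hfc : Continuous f := by fun_prop
  have toK : ∀ μ ∈ Dset P γ ν₀, Rreg piRef μ ≠ ⊤ →
      (fun z => μ.real {z}) ∈ occupancySet Q b γ w := by
    intro μ hμ hR
    have := hμ.1
    exact ⟨fun _ => measureReal_nonneg, by simp,
      (mem_Dset_iff_real P hγ0 hγ1 ν₀ μ).1 hμ, eq_zero_of_Rreg_ne_top hR⟩
  have ofK : ∀ p ∈ occupancySet Q b γ w, ∃ μ ∈ Dset P γ ν₀,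
      (∀ z, (piRef z.1).real {z.2} = 0 → μ.real {z} = 0) ∧ (fun z => μ.real {z}) = p := by
    rintro p ⟨h0, h1, hflow, hac⟩
    obtain ⟨μ, hμ, rfl⟩ := exists_isProbabilityMeasure_real_singleton h0 h1
    exact ⟨μ, (mem_Dset_iff_real P hγ0 hγ1 ν₀ μ).2 hflow, hac, rfl⟩
  have J0 : ∀ μ ∈ Dset P γ ν₀, Jobj 0 r piRef μ = (f fun z => μ.real {z} : ℝ) := fun μ hμ => by
    have := hμ.1
    exact Jobj_zero r piRef μ
  obtain ⟨μs, hs, hsmax, hsR⟩ := hassump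
  have hfs : ∀ μ ∈ Dset P γ ν₀, f (fun z => μ.real {z}) ≤ f fun z => μs.real {z} :=
    fun μ hμ => by simpa [J0 μ hμ, J0 μs hs] using hsmax μ hμ
  obtain ⟨q, ⟨hqK, hqs⟩, hqmin⟩ :=
    ((isCompact_occupancySet Q b γ w).inter_right
      (isClosed_le (continuous_const (y := f fun z => μs.real {z})) hfc)).exists_isMinOn
      ⟨_, toK μs hs hsR, le_refl (f _)⟩ (continuous_condRelEntropy w).continuousOn
  change f (fun z => μs.real {z}) ≤ f q at hqs
  have hqmin' : ∀ y ∈ occupancySet Q b γ w, f q ≤ f y →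
      condRelEntropy w q ≤ condRelEntropy w y :=
    fun y hy hqy => isMinOn_iff.1 hqmin y ⟨hy, hqs.trans hqy⟩
  have huniq : ∀ y ∈ occupancySet Q b γ w, f q ≤ f y →
      condRelEntropy w y ≤ condRelEntropy w q → y = q := by
    intro y hy hqy hH
    have hmid := hqmin' _ (midpoint_mem_occupancySet hy hqK) (by
      simp only [hf] at hqy ⊢
      simp only [add_div, add_mul, Finset.sum_add_distrib, div_mul_eq_mul_div, ← Finset.sum_div]
      linarith)
    exact occupancy_eq_of_condRelEntropy_midpoint hQ0 hQ1 hγ0 hγ1 hy hqK (by linarith)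
  obtain ⟨μlim, hlim, hac, rfl⟩ := ofK q hqK
  have := hlim.1
  have hlimR := Rreg_eq_ofReal piRef μlim hac
  have hlim_argmax : ∀ μ' ∈ Dset P γ ν₀, Jobj 0 r piRef μ' ≤ Jobj 0 r piRef μlim := by
    intro μ' hμ'
    rw [J0 μ' hμ', J0 μlim hlim]
    exact EReal.coe_le_coe_iff.2 ((hfs μ' hμ').trans hqs)
  have hle_of_argmax : ∀ μ' ∈ Dset P γ ν₀,
      (∀ μ'' ∈ Dset P γ ν₀, Jobj 0 r piRef μ'' ≤ Jobj 0 r piRef μ') →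
      f (fun z => μlim.real {z}) ≤ f fun z => μ'.real {z} := fun μ' hμ' h => by
    simpa [J0 μ' hμ', J0 μlim hlim] using h μlim hlim
  refine ⟨μlim, fun S => ?_, hlim, hlim_argmax, fun μ' hμ' hmax => ?_,
    fun μ' hμ' hmax hmin => ?_⟩
  · have hconv : Tendsto (fun τ z => (μstar τ).real {z}) (𝓝[>] (0 : ℝ))
        (𝓝 fun z => μlim.real {z}) := by
      refine tendsto_of_vanishing_regularization (isCompact_occupancySet Q b γ w) hfc
        (continuous_condRelEntropy w) hqK huniq (fun y hy => ?_) fun τ hτ => ?_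
      · obtain ⟨μ, hμ, -, rfl⟩ := ofK y hy
        exact (hfs μ hμ).trans hqs
      · obtain ⟨hD, hopt, -⟩ := hμstar τ hτ
        have := hD.1
        have hle := hopt μlim hlim
        rw [Jobj_eq_coe r piRef μlim hac] at hle
        have hR : Rreg piRef (μstar τ) ≠ ⊤ := fun h => by
          rw [Jobj_of_Rreg_eq_top hτ r h] at hle
          exact EReal.coe_ne_bot _ (le_bot_iff.1 hle)
        rw [Jobj_eq_coe r piRef (μstar τ) (eq_zero_of_Rreg_ne_top hR)] at hle
        exact ⟨toK _ hD hR, EReal.coe_le_coe_iff.1 hle⟩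
    classical
    have hS : ∀ μ : Measure (X × A), μ S = ∑ z ∈ S.toFinite.toFinset, μ {z} := fun μ => by
      rw [sum_measure_singleton, Set.Finite.coe_toFinset]
    simp only [hS]
    refine tendsto_finsetSum _ fun z _ => ?_
    have hz := (ENNReal.continuous_ofReal.tendsto _).comp ((tendsto_pi_nhds.1 hconv) z)
    rw [ofReal_measureReal] at hz
    refine hz.congr' ?_
    filter_upwards [eventually_mem_nhdsWithin] with τ hτ
    have := (hμstar τ hτ).1.1
    exact ofReal_measureReal
  · by_cases hR : Rreg piRef μ' = ⊤
    · exact hR ▸ le_top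
    have := hμ'.1
    rw [hlimR.2, (Rreg_eq_ofReal piRef μ' (eq_zero_of_Rreg_ne_top hR)).2]
    exact ENNReal.ofReal_le_ofReal (hqmin' _ (toK μ' hμ' hR) (hle_of_argmax μ' hμ' hmax))
  · have hle := hmin μlim hlim hlim_argmax
    rw [hlimR.2] at hle
    have hR : Rreg piRef μ' ≠ ⊤ := ne_top_of_le_ne_top ENNReal.ofReal_ne_top hle
    have := hμ'.1
    rw [(Rreg_eq_ofReal piRef μ' (eq_zero_of_Rreg_ne_top hR)).2,
      ENNReal.ofReal_le_ofReal_iff hlimR.1] at hle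
    have heq := huniq _ (toK μ' hμ' hR) (hle_of_argmax μ' hμ' hmax) hle
    exact Measure.ext_of_measureReal_singleton fun z => congrFun heq z
end

section
/- Let λ be a probability measure on a standard Borel space, let f and g be bounded measurable real-valued functions, and let τ > 0. Then ‖BG_τ(f, λ) − BG_τ(g, λ)‖_TV ≤ min{ √(τ⁻¹ ‖f − g‖_{L∞(λ)}), (1/2) sinh(4 τ⁻¹ ‖f − g‖_{L∞(λ)}) }. Moreover, if ‖f − g‖_{L∞(λ)} < τ/2, then ‖BG_τ(f, λ) − BG_τ(g, λ)‖_TV ≤ ((2e − 3)/4) · τ⁻¹ ‖f − g‖_{L∞(λ)}. -/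
open MeasureTheory ProbabilityTheory ENNReal

/-- Total variation distance between measures: the supremum over measurable sets `E` of
`|π(E) − π′(E)|`. -/
noncomputable def tvDist {Ω : Type*} [MeasurableSpace Ω] (π1 π2 : Measure Ω) : ℝ :=
  ⨆ E : {E : Set Ω // MeasurableSet E}, |(π1 E).toReal - (π2 E).toReal|

/-- The soft value `V_τ(f, λ) = τ log ∫ exp(f/τ) dλ`. -/
noncomputable def softValue {A : Type*} [MeasurableSpace A]
    (τ : ℝ) (f : A → ℝ) (lam : Measure A) : ℝ :=
  τ * Real.log (∫ a, Real.exp (f a / τ) ∂lam)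

/-- The Boltzmann–Gibbs measure `BG_τ(f, λ)`: the probability measure with density
`exp((f − V_τ(f, λ))/τ)` with respect to `λ`. -/
noncomputable def BGmeasure {A : Type*} [MeasurableSpace A]
    (τ : ℝ) (f : A → ℝ) (lam : Measure A) : Measure A :=
  lam.withDensity (fun a => ENNReal.ofReal (Real.exp ((f a - softValue τ f lam) / τ)))

/-- Two weights on a two-point space, each at most `exp d` times the other, normalise to
probabilities at distance at most `tanh (d / 2) ≤ d / 2`. -/
lemma div_add_sub_div_add_le_half {x y u v d : ℝ} (hd : 0 ≤ d)
    (hx : 0 ≤ x) (hy : 0 ≤ y) (hu : 0 ≤ u) (hv : 0 ≤ v) (hxy : 0 < x + y) (huv : 0 < u + v)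
    (hxu : x ≤ Real.exp d * u) (hvy : v ≤ Real.exp d * y) :
    x / (x + y) - u / (u + v) ≤ d / 2 := by
  have hk : 1 ≤ Real.exp d := Real.one_le_exp hd
  have hlog := Real.le_log_one_add_of_nonneg (x := Real.exp d - 1) (by linarith)
  rw [add_sub_cancel, Real.log_exp, div_le_iff₀ (by linarith)] at hlog
  set k := Real.exp d
  have hs : √(x * v) ≤ k * √(u * y) := by
    rw [← Real.sqrt_sq (by linarith : 0 ≤ k), ← Real.sqrt_mul (sq_nonneg k)]
    apply Real.sqrt_le_sqrt
    calc x * v ≤ (k * u) * (k * y) := by gcongr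
      _ = k ^ 2 * (u * y) := by ring
  have hst : 2 * (√(x * v) * √(u * y)) ≤ x * u + y * v := by
    have h : √(x * v) * √(u * y) = √(x * u) * √(y * v) := by
      rw [← Real.sqrt_mul (by positivity), ← Real.sqrt_mul (by positivity)]
      ring_nf
    rw [h]
    have h1 := Real.sq_sqrt (mul_nonneg hx hu)
    have h2 := Real.sq_sqrt (mul_nonneg hy hv)
    nlinarith [sq_nonneg (√(x * u) - √(y * v))]
  have h1 := Real.sq_sqrt (mul_nonneg hx hv)
  have h2 := Real.sq_sqrt (mul_nonneg hu hy)
  have hp : 0 < (x + y) * (u + v) := mul_pos hxy huv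
  have key : (x * v - u * y) * (k + 1) ≤ (k - 1) * ((x + y) * (u + v)) := by
    have h3 := mul_nonneg (sub_nonneg.2 hs)
      (add_nonneg (Real.sqrt_nonneg (x * v)) (Real.sqrt_nonneg (u * y)))
    have h4 := mul_le_mul_of_nonneg_left hst (sub_nonneg.2 hk)
    nlinarith
  rw [div_sub_div _ _ hxy.ne' huv.ne', div_le_iff₀ hp]
  nlinarith [mul_le_mul_of_nonneg_right hlog hp.le]

lemma BGmeasure_eq_tilted {A : Type*} [MeasurableSpace A] (τ : ℝ) (hτ : 0 < τ) (f : A → ℝ)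
    (lam : Measure A) (hpos : 0 < ∫ a, Real.exp (f a / τ) ∂lam) :
    BGmeasure τ f lam = lam.tilted (fun a => f a / τ) := by
  unfold BGmeasure softValue Measure.tilted
  congr 1
  ext a
  rw [sub_div, mul_div_cancel_left₀ _ hτ.ne', Real.exp_sub, Real.exp_log hpos]

lemma integrable_exp_of_bounded {A : Type*} [MeasurableSpace A] {lam : Measure A}
    [IsFiniteMeasure lam] {F : A → ℝ} (hF : Measurable F) (hb : ∃ C : ℝ, ∀ a, |F a| ≤ C) :
    Integrable (fun a => Real.exp (F a)) lam := by
  obtain ⟨C, hC⟩ := hb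
  refine Integrable.of_bound hF.exp.aestronglyMeasurable (Real.exp C) (.of_forall fun a => ?_)
  rw [Real.norm_eq_abs, Real.abs_exp]
  exact Real.exp_le_exp.2 ((le_abs_self _).trans (hC a))

lemma tilted_apply_sub_le_half {A : Type*} [MeasurableSpace A] {lam : Measure A}
    [IsProbabilityMeasure lam] {F G : A → ℝ} {d : ℝ} (hd : 0 ≤ d)
    (hF : Integrable (fun a => Real.exp (F a)) lam)
    (hG : Integrable (fun a => Real.exp (G a)) lam)
    (hFG : ∀ᵐ a ∂lam, |F a - G a| ≤ d) {E : Set A} (hE : MeasurableSet E) :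
    (lam.tilted F E).toReal - (lam.tilted G E).toReal ≤ d / 2 := by
  have happ : ∀ H : A → ℝ, Integrable (fun a => Real.exp (H a)) lam →
      (lam.tilted H E).toReal = (∫ a in E, Real.exp (H a) ∂lam) /
        ((∫ a in E, Real.exp (H a) ∂lam) + ∫ a in Eᶜ, Real.exp (H a) ∂lam) := by
    intro H hH
    rw [tilted_apply_eq_ofReal_integral' _ hE, ENNReal.toReal_ofReal (by positivity),
      integral_div, integral_add_compl hE hH]
  have hle : ∀ (H K : A → ℝ), Integrable (fun a => Real.exp (H a)) lam →
      Integrable (fun a => Real.exp (K a)) lam → (∀ᵐ a ∂lam, H a - K a ≤ d) → ∀ S : Set A,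
      ∫ a in S, Real.exp (H a) ∂lam ≤ Real.exp d * ∫ a in S, Real.exp (K a) ∂lam := by
    intro H K hH hK hHK S
    rw [← integral_const_mul]
    refine integral_mono_ae hH.integrableOn (hK.const_mul _).integrableOn
      (ae_restrict_of_ae (hHK.mono fun a ha => ?_))
    simp only
    rw [← Real.exp_add]
    exact Real.exp_le_exp.2 (by linarith)
  have hpos : ∀ H : A → ℝ, Integrable (fun a => Real.exp (H a)) lam →
      0 < (∫ a in E, Real.exp (H a) ∂lam) + ∫ a in Eᶜ, Real.exp (H a) ∂lam := by
    intro H hH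
    rw [integral_add_compl hE hH]
    exact integral_exp_pos hH
  rw [happ F hF, happ G hG]
  exact div_add_sub_div_add_le_half hd (by positivity) (by positivity) (by positivity)
    (by positivity) (hpos F hF) (hpos G hG)
    (hle F G hF hG (hFG.mono fun a ha => (abs_le.1 ha).2) E)
    (hle G F hG hF (hFG.mono fun a ha => by linarith [(abs_le.1 ha).1]) Eᶜ)

lemma tvDist_le {Ω : Type*} [MeasurableSpace Ω] {π1 π2 : Measure Ω} {c : ℝ}
    (h : ∀ E, MeasurableSet E → |(π1 E).toReal - (π2 E).toReal| ≤ c) : tvDist π1 π2 ≤ c :=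
  have : Nonempty {E : Set Ω // MeasurableSet E} := ⟨⟨∅, .empty⟩⟩
  ciSup_le fun E => h E.1 E.2

lemma tvDist_le_one {Ω : Type*} [MeasurableSpace Ω] (π1 π2 : Measure Ω)
    [IsProbabilityMeasure π1] [IsProbabilityMeasure π2] : tvDist π1 π2 ≤ 1 :=
  tvDist_le fun _ _ => abs_sub_le_of_nonneg_of_le measureReal_nonneg measureReal_le_one
    measureReal_nonneg measureReal_le_one

/-- Total variation bound between Boltzmann–Gibbs measures in terms of the temperature and the
`L∞` distance between their potentials. -/
theorem tvDist_BGmeasure_bound {A : Type*} [MeasurableSpace A] [StandardBorelSpace A]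
    (lam : Measure A) [IsProbabilityMeasure lam]
    (f g : A → ℝ) (hf : Measurable f) (hg : Measurable g)
    (hfb : ∃ C : ℝ, ∀ a, |f a| ≤ C) (hgb : ∃ C : ℝ, ∀ a, |g a| ≤ C)
    (τ : ℝ) (hτ : 0 < τ) :
    tvDist (BGmeasure τ f lam) (BGmeasure τ g lam) ≤
      min (Real.sqrt (τ⁻¹ * essSup (fun a => |f a - g a|) lam))
        ((1 / 2) * Real.sinh (4 * τ⁻¹ * essSup (fun a => |f a - g a|) lam)) ∧
    (essSup (fun a => |f a - g a|) lam < τ / 2 →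
      tvDist (BGmeasure τ f lam) (BGmeasure τ g lam) ≤
        ((2 * Real.exp 1 - 3) / 4) * τ⁻¹ * essSup (fun a => |f a - g a|) lam) := by
  obtain ⟨Cf, hCf⟩ := hfb
  obtain ⟨Cg, hCg⟩ := hgb
  have hF : Integrable (fun a => Real.exp (f a / τ)) lam :=
    integrable_exp_of_bounded (hf.div_const τ) ⟨Cf / τ, fun a => by
      rw [abs_div, abs_of_pos hτ]
      exact div_le_div_of_nonneg_right (hCf a) hτ.le⟩
  have hG : Integrable (fun a => Real.exp (g a / τ)) lam :=
    integrable_exp_of_bounded (hg.div_const τ) ⟨Cg / τ, fun a => by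
      rw [abs_div, abs_of_pos hτ]
      exact div_le_div_of_nonneg_right (hCg a) hτ.le⟩
  have hae : ∀ᵐ a ∂lam, |f a - g a| ≤ essSup (fun a => |f a - g a|) lam :=
    ae_le_essSup ⟨Cf + Cg, Filter.eventually_map.2
      (.of_forall fun a => (abs_sub _ _).trans (add_le_add (hCf a) (hCg a)))⟩
  rw [BGmeasure_eq_tilted τ hτ f lam (integral_exp_pos hF),
    BGmeasure_eq_tilted τ hτ g lam (integral_exp_pos hG)]
  have := isProbabilityMeasure_tilted hF
  have := isProbabilityMeasure_tilted hG
  set s := essSup (fun a => |f a - g a|) lam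
  have hs : 0 ≤ s := by
    obtain ⟨a, ha⟩ := hae.exists
    exact (abs_nonneg _).trans ha
  have hd : 0 ≤ τ⁻¹ * s := by positivity
  have hFG : ∀ᵐ a ∂lam, |f a / τ - g a / τ| ≤ τ⁻¹ * s := hae.mono fun a ha => by
    rw [← sub_div, abs_div, abs_of_pos hτ, div_eq_inv_mul]
    gcongr
  have hGF : ∀ᵐ a ∂lam, |g a / τ - f a / τ| ≤ τ⁻¹ * s := hFG.mono fun a ha => by
    rwa [abs_sub_comm]
  have hhalf : tvDist (lam.tilted fun a => f a / τ) (lam.tilted fun a => g a / τ) ≤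
      τ⁻¹ * s / 2 := tvDist_le fun E hE =>
    abs_sub_le_iff.2 ⟨tilted_apply_sub_le_half hd hF hG hFG hE,
      tilted_apply_sub_le_half hd hG hF hGF hE⟩
  have hone := tvDist_le_one (lam.tilted fun a => f a / τ) (lam.tilted fun a => g a / τ)
  rw [mul_assoc 4, mul_assoc _ τ⁻¹]
  generalize τ⁻¹ * s = d at hd hhalf ⊢
  refine ⟨le_min ?_ ?_, fun _ => ?_⟩
  · rcases le_total d 1 with h | h
    · exact hhalf.trans (Real.le_sqrt_of_sq_le (by nlinarith))
    · exact hone.trans (Real.one_le_sqrt.2 h)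
  · linarith [Real.self_le_sinh_iff.2 (by linarith : 0 ≤ 4 * d)]
  · nlinarith [Real.exp_one_gt_d9]
end

section
/- Assume 𝒜 is a finite set and that the coverage assumption holds with constant p̄ > 0. For each σ > 0 let q*_σ be the unique bounded fixed point of the soft Bellman optimality operator B*_σ, and let q*_ref be the unique bounded fixed point of the Bellman reference-optimality operator B̄. Let σ : (0,∞) → (0,∞) satisfy σ(τ)/τ → 0 as τ → 0⁺. Then for every x ∈ 𝒳, the temperature-decoupled policy π^{τ,σ}ₓ := BG_τ(q*_{σ(τ)}(x,·), π̄ₓ) converges in total variation, as τ → 0⁺, to the optimality-filtered reference policy π*_ref,ₓ, defined as the probability measure proportional to the restriction of π̄ₓ to the set O(x) := {a ∈ 𝒜 : q*_ref(x,a) = max_{a′ ∈ supp(π̄ₓ)} q*_ref(x,a′)}. -/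
open MeasureTheory ProbabilityTheory ENNReal Filter Topology

/-- The Bellman reference-optimality operator. -/
noncomputable def refBellmanOpt {X A : Type*} [MeasurableSpace X] [MeasurableSpace A]
    (γ : ℝ) (r : X × A → ℝ) (P : Kernel (X × A) X) (piRef : Kernel X A)
    (q : X × A → ℝ) : X × A → ℝ :=
  fun p => r p + γ * ∫ x', essSup (fun a => q (x', a)) (piRef x') ∂(P p)

/-- The set of actions achieving the (essential, w.r.t. `π̄ₓ`) maximum of `q(x,·)`. -/
def optActions {X A : Type*} [MeasurableSpace X] [MeasurableSpace A]
    (piRef : Kernel X A) (q : X × A → ℝ) (x : X) : Set A :=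
  {a | q (x, a) = essSup (fun a' => q (x, a')) (piRef x)}

/-- The optimality-filtered reference policy at `x`: the probability measure proportional to the
restriction of `π̄ₓ` to the set of optimal actions. -/
noncomputable def filteredRef {X A : Type*} [MeasurableSpace X] [MeasurableSpace A]
    (piRef : Kernel X A) (q : X × A → ℝ) (x : X) : Measure A :=
  ((piRef x) (optActions piRef q x))⁻¹ • (piRef x).restrict (optActions piRef q x)

lemma ae_le_essSup_real_of_finite {A : Type*} [Finite A] [MeasurableSpace A]
    (f : A → ℝ) (μ : Measure A) : ∀ᵐ a ∂μ, f a ≤ essSup f μ :=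
  ae_le_essSup (Set.finite_range f).bddAbove.isBoundedUnder_of_range

lemma essSup_real_le_of_ae_le {A : Type*} [Finite A] [MeasurableSpace A]
    {f : A → ℝ} {μ : Measure A} [NeZero μ] {c : ℝ} (h : ∀ᵐ a ∂μ, f a ≤ c) :
    essSup f μ ≤ c :=
  limsup_le_of_le
    (Set.finite_range f).bddBelow.isBoundedUnder_of_range.isCoboundedUnder_le h

lemma abs_essSup_sub_essSup_le {A : Type*} [Finite A] [MeasurableSpace A]
    {f g : A → ℝ} {μ : Measure A} [NeZero μ] {D : ℝ} (h : ∀ a, |f a - g a| ≤ D) :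
    |essSup f μ - essSup g μ| ≤ D := by
  have hfg : essSup f μ ≤ essSup g μ + D := by
    refine essSup_real_le_of_ae_le ?_
    filter_upwards [ae_le_essSup_real_of_finite g μ] with a ha
    linarith [(abs_le.1 (h a)).2]
  have hgf : essSup g μ ≤ essSup f μ + D := by
    refine essSup_real_le_of_ae_le ?_
    filter_upwards [ae_le_essSup_real_of_finite f μ] with a ha
    linarith [(abs_le.1 (h a)).1]
  rw [abs_le]
  constructor <;> linarith

lemma measure_eq_essSup_ne_zero {A : Type*} [Finite A] [MeasurableSpace A]
    (f : A → ℝ) (μ : Measure A) [NeZero μ] :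
    μ {a | f a = essSup f μ} ≠ 0 := by
  intro h0
  have hne : ∀ᵐ a ∂μ, f a ≠ essSup f μ := by
    rw [ae_iff]
    simpa using h0
  have hlt : ∀ᵐ a ∂μ, f a < essSup f μ := by
    filter_upwards [hne, ae_le_essSup_real_of_finite f μ] with a h1 h2
    exact lt_of_le_of_ne h2 h1
  have hfin : {a | f a < essSup f μ}.Finite := Set.toFinite _
  obtain ⟨a₀, ha₀, hmax⟩ := Set.exists_max_image _ f hfin hlt.exists
  have hle : essSup f μ ≤ f a₀ :=
    essSup_real_le_of_ae_le (hlt.mono fun a ha => hmax a ha)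
  exact absurd ha₀ (not_lt.2 hle)

lemma softValue_le_essSup {A : Type*} [Finite A] [MeasurableSpace A]
    [MeasurableSingletonClass A] (f : A → ℝ) (μ : Measure A) [IsProbabilityMeasure μ]
    {τ : ℝ} (hτ : 0 < τ) : softValue τ f μ ≤ essSup f μ := by
  have hpos : 0 < ∫ a, Real.exp (f a / τ) ∂μ := integral_exp_pos Integrable.of_finite
  have hle : ∫ a, Real.exp (f a / τ) ∂μ ≤ Real.exp (essSup f μ / τ) := by
    calc _ ≤ ∫ _, Real.exp (essSup f μ / τ) ∂μ := by
          refine integral_mono_ae Integrable.of_finite Integrable.of_finite ?_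
          filter_upwards [ae_le_essSup_real_of_finite f μ] with a ha
          exact Real.exp_le_exp.2 (by gcongr)
      _ = _ := by simp
  have hlog := (Real.log_le_iff_le_exp hpos).2 hle
  rw [softValue, mul_comm]
  exact (le_div_iff₀ hτ).1 hlog

lemma essSup_add_mul_log_le_softValue {A : Type*} [Finite A] [MeasurableSpace A]
    [MeasurableSingletonClass A] (f : A → ℝ) (μ : Measure A) [IsProbabilityMeasure μ]
    {τ p : ℝ} (hτ : 0 < τ) (hp : 0 < p) (hcov : p ≤ μ.real {a | f a = essSup f μ}) :
    essSup f μ + τ * Real.log p ≤ softValue τ f μ := by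
  have hmarkov := mul_meas_ge_le_integral_of_nonneg (μ := μ)
    (f := fun a => Real.exp (f a / τ)) (Eventually.of_forall fun a => (Real.exp_pos _).le)
    Integrable.of_finite (Real.exp (essSup f μ / τ))
  have hsub : p ≤ μ.real {a | Real.exp (essSup f μ / τ) ≤ Real.exp (f a / τ)} := by
    refine hcov.trans (measureReal_mono ?_)
    intro a ha
    simp only [Set.mem_ofPred_eq] at ha ⊢
    rw [ha]
  have hle : Real.exp (essSup f μ / τ) * p ≤ ∫ a, Real.exp (f a / τ) ∂μ :=
    (mul_le_mul_of_nonneg_left hsub (Real.exp_pos _).le).trans hmarkov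
  have hlog := Real.log_le_log (mul_pos (Real.exp_pos _) hp) hle
  rw [Real.log_mul (Real.exp_ne_zero _) hp.ne', Real.log_exp] at hlog
  have := mul_le_mul_of_nonneg_left hlog hτ.le
  rwa [mul_add, mul_div_cancel₀ _ hτ.ne'] at this

lemma measurable_softV {X A : Type*} [MeasurableSpace X] [MeasurableSpace A]
    (τ : ℝ) (κ : Kernel X A) [IsSFiniteKernel κ] {q : X × A → ℝ} (hq : Measurable q) :
    Measurable (softV τ κ q) := by
  have h : StronglyMeasurable fun p : X × A => Real.exp (q p / τ) :=
    (Real.measurable_exp.comp (hq.div_const τ)).stronglyMeasurable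
  exact (Real.measurable_log.comp h.integral_kernel_prod_right'.measurable).const_mul τ

/-- Fixed points of the soft and of the reference Bellman operators are uniformly close. -/
lemma abs_soft_fixedPoint_sub_ref_fixedPoint_le
    {X A : Type*} [MeasurableSpace X] [Finite A] [MeasurableSpace A]
    [MeasurableSingletonClass A]
    {P : Kernel (X × A) X} [IsMarkovKernel P] {κ : Kernel X A} [IsMarkovKernel κ]
    {r : X × A → ℝ} {γ : ℝ} (hγ0 : 0 < γ) (hγ1 : γ < 1)
    {s p : ℝ} (hs : 0 < s) (hp : 0 < p) (hp1 : p ≤ 1)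
    {q : X × A → ℝ} (hq : BoundedMeasurable q) (hqfix : softBellmanOpt s γ r P κ q = q)
    {q' : X × A → ℝ} (hq' : BoundedMeasurable q')
    (hmeas : Measurable fun x => essSup (fun a => q' (x, a)) (κ x))
    (hq'fix : refBellmanOpt γ r P κ q' = q')
    (hcov : ∀ x, p ≤ (κ x).real (optActions κ q x)) (z : X × A) :
    |q z - q' z| ≤ γ * -Real.log p / (1 - γ) * s := by
  obtain ⟨hqm, C, hC⟩ := hq
  obtain ⟨hqm', C', hC'⟩ := hq'
  have hlog : Real.log p ≤ 0 := Real.log_nonpos hp.le hp1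
  have hbdd : BddAbove (Set.range fun z => |q z - q' z|) := by
    refine ⟨C + C', ?_⟩
    rintro _ ⟨z, rfl⟩
    exact (abs_sub _ _).trans (add_le_add (hC z) (hC' z))
  set D := ⨆ z, |q z - q' z| with hD
  have hDz : ∀ z, |q z - q' z| ≤ D := fun z => le_ciSup hbdd z
  have hD0 : 0 ≤ D := (abs_nonneg _).trans (hDz z)
  have hV : ∀ x, |softV s κ q x - essSup (fun a => q (x, a)) (κ x)| ≤ s * -Real.log p := by
    intro x
    have h1 : softV s κ q x ≤ _ := softValue_le_essSup (fun a => q (x, a)) (κ x) hs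
    have h2 : _ ≤ softV s κ q x :=
      essSup_add_mul_log_le_softValue (fun a => q (x, a)) (κ x) hs hp (hcov x)
    have := mul_nonneg hs.le (neg_nonneg.2 hlog)
    rw [abs_le]
    constructor <;> linarith
  have hE : ∀ x, |essSup (fun a => q (x, a)) (κ x) - essSup (fun a => q' (x, a)) (κ x)| ≤ D :=
    fun x => abs_essSup_sub_essSup_le fun a => hDz (x, a)
  have hE0 : ∀ g : X × A → ℝ, ∀ B : ℝ, (∀ z, |g z| ≤ B) → ∀ x,
      |essSup (fun a => g (x, a)) (κ x)| ≤ B := by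
    intro g B hB x
    have hmem := (measure_eq_essSup_ne_zero (fun a => g (x, a)) (κ x))
    obtain ⟨a, ha⟩ := nonempty_of_measure_ne_zero hmem
    rw [← show g (x, a) = _ from ha]
    exact hB _
  have hdiff : ∀ x, |softV s κ q x - essSup (fun a => q' (x, a)) (κ x)|
      ≤ s * -Real.log p + D :=
    fun x => (abs_sub_le _ _ _).trans (add_le_add (hV x) (hE x))
  have hstep : ∀ z, |q z - q' z| ≤ γ * (s * -Real.log p + D) := by
    intro z
    have hi : Integrable (fun x => essSup (fun a => q' (x, a)) (κ x)) (P z) :=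
      Integrable.of_bound hmeas.aestronglyMeasurable C'
        (Eventually.of_forall fun x => hE0 q' C' hC' x)
    have hi' : Integrable (softV s κ q) (P z) := by
      refine Integrable.of_bound (measurable_softV s κ hqm).aestronglyMeasurable
        (s * -Real.log p + C) (Eventually.of_forall fun x => ?_)
      have := abs_add_le (softV s κ q x - essSup (fun a => q (x, a)) (κ x))
        (essSup (fun a => q (x, a)) (κ x))
      rw [sub_add_cancel] at this
      exact this.trans (add_le_add (hV x) (hE0 q C hC x))
    have hbound := norm_integral_le_of_norm_le_const (μ := P z)
      (f := fun x => softV s κ q x - essSup (fun a => q' (x, a)) (κ x))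
      (Eventually.of_forall fun x => hdiff x)
    rw [integral_sub hi' hi, probReal_univ, mul_one, Real.norm_eq_abs] at hbound
    have hz := congrFun hqfix z
    have hz' := congrFun hq'fix z
    simp only [softBellmanOpt, refBellmanOpt] at hz hz'
    rw [← hz, ← hz', add_sub_add_left_eq_sub, ← mul_sub, abs_mul, abs_of_pos hγ0]
    exact mul_le_mul_of_nonneg_left hbound hγ0.le
  have hDle : D ≤ γ * (s * -Real.log p + D) :=
    Real.iSup_le hstep ((abs_nonneg _).trans (hstep z))
  refine (hDz z).trans ?_
  rw [div_mul_eq_mul_div, le_div_iff₀ (by linarith)]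
  linarith

lemma tvDist_nonneg {Ω : Type*} [MeasurableSpace Ω] (μ ν : Measure Ω) : 0 ≤ tvDist μ ν :=
  Real.iSup_nonneg fun _ => abs_nonneg _

lemma tvDist_le_sum {A : Type*} [Fintype A] [MeasurableSpace A] [MeasurableSingletonClass A]
    (μ ν : Measure A) [IsFiniteMeasure μ] [IsFiniteMeasure ν] :
    tvDist μ ν ≤ ∑ a, |μ.real {a} - ν.real {a}| := by
  classical
  refine Real.iSup_le ?_ (Finset.sum_nonneg fun _ _ => abs_nonneg _)
  rintro ⟨E, -⟩
  have h : ∀ ρ : Measure A, [IsFiniteMeasure ρ] → (ρ E).toReal = ∑ a ∈ E.toFinset, ρ.real {a} := by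
    intro ρ _
    rw [sum_measureReal_singleton, Set.coe_toFinset]
    rfl
  simp only [h μ, h ν, ← Finset.sum_sub_distrib]
  exact (Finset.abs_sum_le_sum_abs _ _).trans
    (Finset.sum_le_sum_of_subset_of_nonneg (Finset.subset_univ _) fun _ _ _ => abs_nonneg _)

/-- The Boltzmann–Gibbs weights, normalised by an arbitrary additive constant `c`. -/
lemma BGmeasure_real_singleton {A : Type*} [Fintype A] [MeasurableSpace A]
    [MeasurableSingletonClass A] (μ : Measure A) [IsProbabilityMeasure μ]
    {τ : ℝ} (hτ : 0 < τ) (f : A → ℝ) (c : ℝ) (a : A) :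
    (BGmeasure τ f μ).real {a} =
      μ.real {a} * Real.exp ((f a - c) / τ) / ∑ b, μ.real {b} * Real.exp ((f b - c) / τ) := by
  have hpos : 0 < ∫ a, Real.exp (f a / τ) ∂μ := integral_exp_pos Integrable.of_finite
  have hsum : ∫ a, Real.exp (f a / τ) ∂μ
      = Real.exp (c / τ) * ∑ b, μ.real {b} * Real.exp ((f b - c) / τ) := by
    rw [integral_fintype Integrable.of_finite, Finset.mul_sum]
    refine Finset.sum_congr rfl fun b _ => ?_
    rw [smul_eq_mul, mul_left_comm, ← Real.exp_add]
    congr 2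
    ring
  have hexp : Real.exp ((f a - softValue τ f μ) / τ)
      = Real.exp (f a / τ) / ∫ a, Real.exp (f a / τ) ∂μ := by
    rw [softValue, sub_div, mul_div_cancel_left₀ _ hτ.ne', Real.exp_sub, Real.exp_log hpos]
  rw [measureReal_def, BGmeasure, withDensity_apply _ (measurableSet_singleton a),
    lintegral_singleton, ENNReal.toReal_mul, ENNReal.toReal_ofReal (Real.exp_pos _).le, hexp, hsum,
    sub_div (f a), Real.exp_sub, measureReal_def]
  field_simp

lemma isFiniteMeasure_BGmeasure {A : Type*} [Finite A] [MeasurableSpace A]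
    [MeasurableSingletonClass A] (μ : Measure A) [IsFiniteMeasure μ] (τ : ℝ) (f : A → ℝ) :
    IsFiniteMeasure (BGmeasure τ f μ) :=
  isFiniteMeasure_withDensity_ofReal Integrable.of_finite.2

/-- Low temperature limit of Boltzmann–Gibbs weights for energies converging faster than the
temperature. -/
lemma tendsto_BGmeasure_real_singleton {A : Type*} [Fintype A] [MeasurableSpace A]
    [MeasurableSingletonClass A] (μ : Measure A) [IsProbabilityMeasure μ]
    (F : ℝ → A → ℝ) (f : A → ℝ)
    (hF : ∀ a, Tendsto (fun τ => (F τ a - f a) / τ) (𝓝[>] (0 : ℝ)) (𝓝 0)) (a : A) :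
    Tendsto (fun τ => (BGmeasure τ (F τ) μ).real {a}) (𝓝[>] (0 : ℝ))
      (𝓝 (({b | f b = essSup f μ}.indicator (fun b => μ.real {b}) a)
        / μ.real {b | f b = essSup f μ})) := by
  classical
  set M := essSup f μ with hM
  set O := {b | f b = M} with hO
  have hw : ∀ b, Tendsto (fun τ => μ.real {b} * Real.exp ((F τ b - M) / τ)) (𝓝[>] (0 : ℝ))
      (𝓝 (O.indicator (fun b => μ.real {b}) b)) := by
    intro b
    by_cases hb : b ∈ O
    · have hb' : f b = M := hb
      rw [Set.indicator_of_mem hb]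
      have := ((Real.continuous_exp.tendsto 0).comp (hF b)).const_mul (μ.real {b})
      rw [Real.exp_zero, mul_one, hb'] at this
      exact this
    · rw [Set.indicator_of_notMem hb]
      by_cases h0 : μ.real {b} = 0
      · simp [h0]
      have hle : f b ≤ M := by
        have hae := ae_le_essSup_real_of_finite f μ
        by_contra hlt
        refine h0 ?_
        rw [measureReal_eq_zero_iff]
        refine measure_mono_null ?_ (ae_iff.1 hae)
        rintro _ rfl
        exact hlt
      have hlt : f b - M < 0 := sub_neg.2 (lt_of_le_of_ne hle hb)
      have hbot : Tendsto (fun τ : ℝ => (f b - M) * τ⁻¹) (𝓝[>] (0 : ℝ)) atBot :=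
        tendsto_inv_nhdsGT_zero.const_mul_atTop_of_neg hlt
      have hexp := (Real.tendsto_exp_atBot.comp ((hF b).add_atBot hbot)).const_mul (μ.real {b})
      rw [mul_zero] at hexp
      refine hexp.congr fun τ => ?_
      simp only [Function.comp]
      congr 2
      ring
  have hsum : ∑ b, O.indicator (fun b => μ.real {b}) b = μ.real O := by
    simp only [Set.indicator_apply]
    rw [← Finset.sum_filter, sum_measureReal_singleton]
    congr 1
    ext b
    simp
  have hO0 : μ.real O ≠ 0 := by
    rw [Ne, measureReal_eq_zero_iff]
    exact measure_eq_essSup_ne_zero f μ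
  have hZ := tendsto_finsetSum Finset.univ fun b _ => hw b
  rw [hsum] at hZ
  refine ((hw a).div hZ hO0).congr' ?_
  filter_upwards [self_mem_nhdsWithin] with τ hτ
  exact (BGmeasure_real_singleton μ hτ (F τ) M a).symm

lemma filteredRef_real_singleton {X A : Type*} [MeasurableSpace X] [Finite A]
    [MeasurableSpace A] [MeasurableSingletonClass A] (κ : Kernel X A)
    (q : X × A → ℝ) (x : X) (a : A) :
    (filteredRef κ q x).real {a} =
      (optActions κ q x).indicator (fun b => (κ x).real {b}) a
        / (κ x).real (optActions κ q x) := by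
  rw [filteredRef, measureReal_ennreal_smul_apply, ENNReal.toReal_inv, div_eq_inv_mul,
    measureReal_restrict_apply (measurableSet_singleton a), ← measureReal_def]
  by_cases ha : a ∈ optActions κ q x
  · rw [Set.indicator_of_mem ha, Set.inter_eq_left.2 (Set.singleton_subset_iff.2 ha)]
  · rw [Set.indicator_of_notMem ha, Set.singleton_inter_eq_empty.2 ha, measureReal_empty]

lemma isFiniteMeasure_filteredRef {X A : Type*} [MeasurableSpace X] [Finite A]
    [MeasurableSpace A] (κ : Kernel X A) [IsMarkovKernel κ] (q : X × A → ℝ) (x : X) :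
    IsFiniteMeasure (filteredRef κ q x) :=
  Measure.smul_finite _ (ENNReal.inv_ne_top.2 (measure_eq_essSup_ne_zero _ _))


/-- Temperature decoupling: under the coverage assumption, if `σ(τ)/τ → 0` as `τ → 0⁺`, then the
temperature-decoupled policies `π^{τ,σ}ₓ = BG_τ(q*_{σ(τ)}(x,·), π̄ₓ)` converge in total
variation, as `τ → 0⁺`, to the optimality-filtered reference policy. -/
theorem decoupled_policy_tendsto_filteredRef
    {X A : Type*} [MeasurableSpace X] [StandardBorelSpace X]
    [Fintype A] [MeasurableSpace A] [MeasurableSingletonClass A]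
    (P : Kernel (X × A) X) [IsMarkovKernel P]
    (piRef : Kernel X A) [IsMarkovKernel piRef]
    (r : X × A → ℝ) (hr : BoundedMeasurable r)
    (γ : ℝ) (hγ0 : 0 < γ) (hγ1 : γ < 1)
    (qsig : ℝ → X × A → ℝ)
    (hqsig : ∀ s : ℝ, 0 < s →
      BoundedMeasurable (qsig s) ∧ softBellmanOpt s γ r P piRef (qsig s) = qsig s)
    (qref : X × A → ℝ) (hqref : BoundedMeasurable qref)
    (hqrefmeas : Measurable (fun x' => essSup (fun a => qref (x', a)) (piRef x')))
    (hqrefFix : refBellmanOpt γ r P piRef qref = qref)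
    (pbar : ℝ) (hpbar : 0 < pbar)
    (hcov : ∀ τ : ℝ, 0 < τ → ∀ x : X,
      ENNReal.ofReal pbar ≤ piRef x (optActions piRef (qsig τ) x))
    (σ : ℝ → ℝ) (hσpos : ∀ τ : ℝ, 0 < τ → 0 < σ τ)
    (hσ : Tendsto (fun τ => σ τ / τ) (𝓝[>] (0 : ℝ)) (𝓝 0)) :
    ∀ x : X,
      Tendsto
        (fun τ => tvDist (BGmeasure τ (fun a => qsig (σ τ) (x, a)) (piRef x))
          (filteredRef piRef qref x))
        (𝓝[>] (0 : ℝ)) (𝓝 0) := by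
  intro x
  have hcovr : ∀ τ, 0 < τ → ∀ x, pbar ≤ (piRef x).real (optActions piRef (qsig τ) x) :=
    fun τ hτ x => (ENNReal.ofReal_le_iff_le_toReal (measure_ne_top _ _)).1 (hcov τ hτ x)
  have hp1 : pbar ≤ 1 := (hcovr 1 one_pos x).trans measureReal_le_one
  have hlim : ∀ a, Tendsto (fun τ => (qsig (σ τ) (x, a) - qref (x, a)) / τ) (𝓝[>] (0 : ℝ))
      (𝓝 0) := by
    intro a
    have hK := hσ.const_mul (γ * -Real.log pbar / (1 - γ))
    rw [mul_zero] at hK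
    refine squeeze_zero_norm' ?_ hK
    filter_upwards [self_mem_nhdsWithin] with τ hτ
    have hτ0 : 0 < τ := hτ
    rw [Real.norm_eq_abs, abs_div, abs_of_pos hτ0, ← mul_div_assoc]
    gcongr
    exact abs_soft_fixedPoint_sub_ref_fixedPoint_le hγ0 hγ1 (hσpos τ hτ) hpbar hp1
      (hqsig _ (hσpos τ hτ)).1 (hqsig _ (hσpos τ hτ)).2 hqref hqrefmeas hqrefFix
      (hcovr _ (hσpos τ hτ)) (x, a)
  have hsum : Tendsto (fun τ => ∑ a, |(BGmeasure τ (fun a => qsig (σ τ) (x, a)) (piRef x)).real {a}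
      - (filteredRef piRef qref x).real {a}|) (𝓝[>] (0 : ℝ)) (𝓝 0) := by
    suffices h : ∀ a : A, Tendsto (fun τ =>
        |(BGmeasure τ (fun a => qsig (σ τ) (x, a)) (piRef x)).real {a}
          - (filteredRef piRef qref x).real {a}|) (𝓝[>] (0 : ℝ)) (𝓝 0) by
      simpa using tendsto_finsetSum Finset.univ fun a _ => h a
    intro a
    have h := tendsto_BGmeasure_real_singleton (piRef x) (fun τ a => qsig (σ τ) (x, a))
      (fun a => qref (x, a)) hlim a
    rw [filteredRef_real_singleton]
    have h' := (h.sub_const ((optActions piRef qref x).indicator (fun b => (piRef x).real {b}) a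
      / (piRef x).real (optActions piRef qref x))).abs
    rw [optActions, sub_self, abs_zero] at h'
    exact h'
  refine squeeze_zero (fun τ => tvDist_nonneg _ _) (fun τ => ?_) hsum
  have := isFiniteMeasure_BGmeasure (piRef x) τ fun a => qsig (σ τ) (x, a)
  have := isFiniteMeasure_filteredRef piRef qref x
  exact tvDist_le_sum _ _
end

section
/- Let π and π′ be mutually absolutely continuous probability measures on a measurable space, and let h := dπ/dπ′ be the Radon–Nikodym derivative. Then ‖π − π′‖_TV ≤ (1/4) ( esssup_{π′} h − essinf_{π′} h ), where esssup and essinf are taken with respect to π′. -/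
open MeasureTheory ProbabilityTheory ENNReal

theorem abs_sub_le_quarter_of_mul_bounds {a b p q : ℝ} (hp0 : 0 ≤ p) (hp1 : p ≤ 1)
    (ha : a * p ≤ q) (hb : q ≤ b * p)
    (ha' : a * (1 - p) ≤ 1 - q) (hb' : 1 - q ≤ b * (1 - p)) :
    |q - p| ≤ (b - a) / 4 := by
  have hp1' : 0 ≤ 1 - p := sub_nonneg.2 hp1
  have hab : 0 ≤ b - a := by nlinarith
  have key : p * (1 - p) * (b - a) ≤ (b - a) / 4 := by
    nlinarith [mul_nonneg hab (sq_nonneg (2 * p - 1))]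
  rw [abs_le]
  constructor
  · nlinarith [mul_le_mul_of_nonneg_left ha hp1', mul_le_mul_of_nonneg_left hb' hp0]
  · nlinarith [mul_le_mul_of_nonneg_left hb hp1', mul_le_mul_of_nonneg_left ha' hp0]

theorem measureReal_mem_Icc_of_rnDeriv_mem_Icc {Ω : Type*} [MeasurableSpace Ω]
    {μ ν : Measure Ω} [IsFiniteMeasure μ] [IsFiniteMeasure ν] (hac : μ ≪ ν) {a b : ℝ}
    (hab : ∀ᵐ x ∂ν, (μ.rnDeriv ν x).toReal ∈ Set.Icc a b) (E : Set Ω) :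
    μ.real E ∈ Set.Icc (a * ν.real E) (b * ν.real E) := by
  have hint : IntegrableOn (fun x => (μ.rnDeriv ν x).toReal) E ν :=
    Measure.integrable_toReal_rnDeriv.integrableOn
  have hE := ae_restrict_of_ae (s := E) hab
  rw [← Measure.setIntegral_toReal_rnDeriv hac E]
  constructor
  · calc a * ν.real E = ∫ _ in E, a ∂ν := by simp [mul_comm]
      _ ≤ _ := integral_mono_ae (integrable_const a) hint (hE.mono fun x hx => hx.1)
  · calc _ ≤ ∫ _ in E, b ∂ν :=
          integral_mono_ae hint (integrable_const b) (hE.mono fun x hx => hx.2)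
      _ = b * ν.real E := by simp [mul_comm]

theorem tvDist_le_of_rnDeriv_mem_Icc {Ω : Type*} [MeasurableSpace Ω]
    {μ ν : Measure Ω} [IsProbabilityMeasure μ] [IsProbabilityMeasure ν] (hac : μ ≪ ν) {a b : ℝ}
    (hab : ∀ᵐ x ∂ν, (μ.rnDeriv ν x).toReal ∈ Set.Icc a b) :
    tvDist μ ν ≤ (b - a) / 4 := by
  have : Nonempty {E : Set Ω // MeasurableSet E} := ⟨⟨∅, MeasurableSet.empty⟩⟩
  refine ciSup_le fun ⟨E, hE⟩ => ?_
  have h₁ := measureReal_mem_Icc_of_rnDeriv_mem_Icc hac hab E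
  have h₂ := measureReal_mem_Icc_of_rnDeriv_mem_Icc hac hab Eᶜ
  rw [probReal_compl_eq_one_sub hE, probReal_compl_eq_one_sub hE] at h₂
  exact abs_sub_le_quarter_of_mul_bounds measureReal_nonneg measureReal_le_one
    h₁.1 h₁.2 h₂.1 h₂.2

/-- For mutually absolutely continuous probability measures `π ≪≫ π′` with Radon–Nikodym
derivative `h = dπ/dπ′`, the total variation distance satisfies
`‖π − π′‖_TV ≤ (1/4)(esssup_{π′} h − essinf_{π′} h)` (in the extended reals). -/
theorem tvDist_le_quarter_essOsc_rnDeriv {Ω : Type*} [MeasurableSpace Ω]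
    (π1 π2 : Measure Ω) [IsProbabilityMeasure π1] [IsProbabilityMeasure π2]
    (hac : π1 ≪ π2) (hac' : π2 ≪ π1)
    (h : Ω → ℝ)
    (hh : h =ᵐ[π2] fun x => (π1.rnDeriv π2 x).toReal) :
    (tvDist π1 π2 : EReal) ≤
      (1 / 4 : EReal) *
        (essSup (fun x => (h x : EReal)) π2 - essInf (fun x => (h x : EReal)) π2) := by
  have quarter : (1 / 4 : EReal) = ((1 / 4 : ℝ) : EReal) := by norm_cast
  have hsup : ∀ᵐ x ∂π2, (h x : EReal) ≤ essSup (fun x => (h x : EReal)) π2 := ae_le_essSup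
  have hinf : ∀ᵐ x ∂π2, essInf (fun x => (h x : EReal)) π2 ≤ (h x : EReal) := ae_essInf_le
  have hinf_nonneg : 0 ≤ essInf (fun x => (h x : EReal)) π2 :=
    le_essInf_of_ae_le _ (hh.mono fun x hx => by
      simp only [hx]
      exact_mod_cast toReal_nonneg)
  obtain ⟨x₀, hx₀, hx₀'⟩ := (hsup.and hinf).exists
  generalize essSup (fun x => (h x : EReal)) π2 = M at *
  generalize essInf (fun x => (h x : EReal)) π2 = m at *
  have hm : m ≠ ⊤ := (hx₀'.trans_lt (EReal.coe_lt_top _)).ne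
  have hm' : m ≠ ⊥ := (EReal.bot_lt_zero.trans_le hinf_nonneg).ne'
  have hM' : M ≠ ⊥ := ((EReal.bot_lt_coe _).trans_le hx₀).ne'
  lift m to ℝ using ⟨hm, hm'⟩
  rw [quarter]
  by_cases hM : M = ⊤
  · rw [hM, EReal.top_sub_coe, EReal.coe_mul_top_of_pos (by norm_num)]
    exact le_top
  lift M to ℝ using ⟨hM, hM'⟩
  have hab : ∀ᵐ x ∂π2, (π1.rnDeriv π2 x).toReal ∈ Set.Icc m M := by
    filter_upwards [hh, hsup, hinf] with x hx hxM hxm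
    rw [← hx]
    exact ⟨EReal.coe_le_coe_iff.1 hxm, EReal.coe_le_coe_iff.1 hxM⟩
  have key := tvDist_le_of_rnDeriv_mem_Icc hac hab
  rw [← EReal.coe_sub, ← EReal.coe_mul, EReal.coe_le_coe_iff]
  linarith
end

section
/- Let λ be a finite measure on a measurable space 𝒴 and let u, w be bounded measurable real-valued functions on 𝒴 with λ not the zero measure. Let π^u and π^w be the Gibbs probability measures with densities proportional to e^{−u} and e^{−w} with respect to λ, respectively. Then ‖π^u − π^w‖_TV ≤ (1/2) sinh( 2 ‖u − w‖_{L∞(λ)} ). -/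
open MeasureTheory ProbabilityTheory ENNReal

/-- The Gibbs probability measure with density proportional to `e^{−u}` with respect to `λ`. -/
noncomputable def gibbs {Y : Type*} [MeasurableSpace Y] (lam : Measure Y) (u : Y → ℝ) :
    Measure Y :=
  (∫⁻ y, ENNReal.ofReal (Real.exp (-u y)) ∂lam)⁻¹ •
    lam.withDensity (fun y => ENNReal.ofReal (Real.exp (-u y)))

theorem integrable_exp_neg_of_bounded {Y : Type*} [MeasurableSpace Y] {lam : Measure Y}
    [IsFiniteMeasure lam] {u : Y → ℝ} (hu : Measurable u) (hub : ∃ C : ℝ, ∀ y, |u y| ≤ C) :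
    Integrable (fun y => Real.exp (-u y)) lam := by
  obtain ⟨C, hC⟩ := hub
  refine Integrable.of_bound (C := Real.exp C) (by fun_prop) (.of_forall fun y => ?_)
  rw [Real.norm_eq_abs, Real.abs_exp, Real.exp_le_exp]
  linarith [neg_abs_le (u y), hC y]

theorem gibbs_toReal_apply {Y : Type*} [MeasurableSpace Y] {lam : Measure Y} {u : Y → ℝ}
    (hu : Integrable (fun y => Real.exp (-u y)) lam) {E : Set Y} (hE : MeasurableSet E) :
    (gibbs lam u E).toReal =
      (∫ y in E, Real.exp (-u y) ∂lam) / ∫ y, Real.exp (-u y) ∂lam := by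
  have hnn : ∀ μ : Measure Y, 0 ≤ᵐ[μ] fun y => Real.exp (-u y) :=
    fun μ => .of_forall fun y => (Real.exp_pos _).le
  rw [gibbs, Measure.smul_apply, withDensity_apply _ hE, smul_eq_mul, ENNReal.toReal_mul,
    ENNReal.toReal_inv, ← integral_eq_lintegral_of_nonneg_ae (hnn _) hu.1,
    ← integral_eq_lintegral_of_nonneg_ae (hnn _) hu.1.restrict, inv_mul_eq_div]

/-- If the potentials differ by at most `δ` almost everywhere, the Gibbs measures have density at
most `exp (2 δ)` with respect to each other. -/
theorem gibbs_toReal_le_exp_mul {Y : Type*} [MeasurableSpace Y] {lam : Measure Y}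
    (hlam : lam ≠ 0) {u w : Y → ℝ} (hu : Integrable (fun y => Real.exp (-u y)) lam)
    (hw : Integrable (fun y => Real.exp (-w y)) lam) {δ : ℝ}
    (hδ : ∀ᵐ y ∂lam, |u y - w y| ≤ δ) {E : Set Y} (hE : MeasurableSet E) :
    (gibbs lam u E).toReal ≤ Real.exp (2 * δ) * (gibbs lam w E).toReal := by
  have : NeZero lam := ⟨hlam⟩
  have hZu : 0 < ∫ y, Real.exp (-u y) ∂lam := integral_exp_pos hu
  have hZw : 0 < ∫ y, Real.exp (-w y) ∂lam := integral_exp_pos hw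
  have hnum : ∫ y in E, Real.exp (-u y) ∂lam ≤ Real.exp δ * ∫ y in E, Real.exp (-w y) ∂lam := by
    rw [← integral_const_mul]
    refine integral_mono_ae hu.restrict (hw.restrict.const_mul _) (ae_restrict_of_ae ?_)
    filter_upwards [hδ] with y hy
    rw [← Real.exp_add, Real.exp_le_exp]
    linarith [(abs_le.1 hy).1]
  have hden : ∫ y, Real.exp (-w y) ∂lam ≤ Real.exp δ * ∫ y, Real.exp (-u y) ∂lam := by
    rw [← integral_const_mul]
    refine integral_mono_ae hw (hu.const_mul _) ?_
    filter_upwards [hδ] with y hy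
    rw [← Real.exp_add, Real.exp_le_exp]
    linarith [(abs_le.1 hy).2]
  have hA : 0 ≤ ∫ y in E, Real.exp (-w y) ∂lam := integral_nonneg fun y => (Real.exp_pos _).le
  rw [gibbs_toReal_apply hu hE, gibbs_toReal_apply hw hE, ← mul_div_assoc, div_le_div_iff₀ hZu hZw,
    two_mul, Real.exp_add]
  calc _ ≤ (Real.exp δ * ∫ y in E, Real.exp (-w y) ∂lam) *
        (Real.exp δ * ∫ y, Real.exp (-u y) ∂lam) :=
        mul_le_mul hnum hden hZw.le (mul_nonneg (Real.exp_pos _).le hA)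
    _ = _ := by ring

theorem isProbabilityMeasure_gibbs {Y : Type*} [MeasurableSpace Y] {lam : Measure Y}
    (hlam : lam ≠ 0) {u : Y → ℝ} (hu : Integrable (fun y => Real.exp (-u y)) lam) :
    IsProbabilityMeasure (gibbs lam u) := by
  have : NeZero lam := ⟨hlam⟩
  have h := gibbs_toReal_apply hu MeasurableSet.univ
  rw [setIntegral_univ, div_self (integral_exp_pos hu).ne'] at h
  exact ⟨(ENNReal.toReal_eq_one_iff _).1 h⟩

theorem sub_le_half_sinh_of_le_exp_mul {p q t : ℝ} (ht : 0 ≤ t) (h : p ≤ Real.exp t * q)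
    (h' : 1 - q ≤ Real.exp t * (1 - p)) : p - q ≤ 1 / 2 * Real.sinh t := by
  have hK : 1 ≤ Real.exp t := Real.one_le_exp ht
  rw [Real.sinh_eq, Real.exp_neg]
  set K := Real.exp t
  have hd : p - q ≤ (K - 1) / (K + 1) := by
    rw [le_div_iff₀ (by linarith)]
    linarith
  refine hd.trans ?_
  have hrhs : 1 / 2 * ((K - K⁻¹) / 2) - (K - 1) / (K + 1) =
      (K - 1) ^ 3 / (4 * K * (K + 1)) := by
    field_simp
    ring
  have : 0 ≤ (K - 1) ^ 3 / (4 * K * (K + 1)) :=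
    div_nonneg (pow_nonneg (by linarith) 3) (by positivity)
  linarith

/-- For bounded measurable potentials `u, w` on a finite nonzero measure `λ`, the Gibbs measures
satisfy `‖π^u − π^w‖_TV ≤ (1/2) sinh(2 ‖u − w‖_{L∞(λ)})`. -/
theorem tvDist_gibbs_le_sinh {Y : Type*} [MeasurableSpace Y]
    (lam : Measure Y) [IsFiniteMeasure lam] (hlam : lam ≠ 0)
    (u w : Y → ℝ) (hu : Measurable u) (hw : Measurable w)
    (hub : ∃ C : ℝ, ∀ y, |u y| ≤ C) (hwb : ∃ C : ℝ, ∀ y, |w y| ≤ C) :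
    tvDist (gibbs lam u) (gibbs lam w) ≤
      (1 / 2) * Real.sinh (2 * essSup (fun y => |u y - w y|) lam) := by
  have hui := integrable_exp_neg_of_bounded (lam := lam) hu hub
  have hwi := integrable_exp_neg_of_bounded (lam := lam) hw hwb
  have := isProbabilityMeasure_gibbs hlam hui
  have := isProbabilityMeasure_gibbs hlam hwi
  obtain ⟨C, hC⟩ := hub
  obtain ⟨D, hD⟩ := hwb
  have hδ : ∀ᵐ y ∂lam, |u y - w y| ≤ essSup (fun y => |u y - w y|) lam :=
    ae_le_essSup (Filter.isBoundedUnder_of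
      ⟨C + D, fun y => (abs_sub _ _).trans (add_le_add (hC y) (hD y))⟩)
  set δ := essSup (fun y => |u y - w y|) lam
  have hδ' : ∀ᵐ y ∂lam, |w y - u y| ≤ δ := by simpa only [abs_sub_comm] using hδ
  have : NeZero lam := ⟨hlam⟩
  obtain ⟨y, hy⟩ := hδ.exists
  have hδ0 : 0 ≤ 2 * δ := by linarith [abs_nonneg (u y - w y)]
  have : Nonempty {E : Set Y // MeasurableSet E} := ⟨⟨∅, .empty⟩⟩
  refine ciSup_le fun ⟨E, hE⟩ => ?_
  have h₁ := gibbs_toReal_le_exp_mul hlam hui hwi hδ hE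
  have h₂ := gibbs_toReal_le_exp_mul hlam hwi hui hδ' hE
  have h₃ := gibbs_toReal_le_exp_mul hlam hui hwi hδ hE.compl
  have h₄ := gibbs_toReal_le_exp_mul hlam hwi hui hδ' hE.compl
  simp only [← measureReal_def, probReal_compl_eq_one_sub hE] at h₁ h₂ h₃ h₄ ⊢
  rw [abs_sub_le_iff]
  exact ⟨sub_le_half_sinh_of_le_exp_mul hδ0 h₁ h₄, sub_le_half_sinh_of_le_exp_mul hδ0 h₂ h₃⟩
end
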